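/- Every finite simple graph G with maximum degree Δ and girth at least 219 admits an acyclic edge coloring using at most ⌈2.323(Δ-1)⌉ + 1 colors; that is, there is a proper edge coloring of G with ⌈2.323(Δ-1)⌉ + 1 colors under which every cycle of G receives at least three distinct colors on its edges. -/

import Mathlib

/-- `col` is a proper edge coloring of `G`: distinct edges sharing an endpoint
receive distinct colors. -/
def IsProperEdgeColoring {V : Type*} (G : SimpleGraph V) (col : Sym2 V → ℕ) : Prop :=
  ∀ e₁ ∈ G.edgeSet, ∀ e₂ ∈ G.edgeSet, e₁ ≠ e₂ → (∃ v, v ∈ e₁ ∧ v ∈ e₂) →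
    col e₁ ≠ col e₂

open Finset

open Classical in
/-- Independence of events depending on disjoint sets of coordinates. -/
lemma indep_count {I Q : Type*} [Fintype I] [Fintype Q] (A B : (I → Q) → Prop) (T : Finset I)
    (hA : ∀ f g, (∀ i ∉ T, f i = g i) → A f → A g)
    (hB : ∀ f g, (∀ i ∈ T, f i = g i) → B f → B g) :
    #{f : I → Q | A f ∧ B f} * Fintype.card (I → Q) = #{f : I → Q | A f} * #{f : I → Q | B f} := by
  rw [← Finset.card_univ, ← Finset.card_product, ← Finset.card_product]
  refine Finset.card_nbij' (fun x => (T.piecewise x.2 x.1, T.piecewise x.1 x.2))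
    (fun x => (T.piecewise x.2 x.1, T.piecewise x.1 x.2)) ?_ ?_ ?_ ?_
  · rintro ⟨f, g⟩ h
    simp only [coe_product, coe_filter, mem_univ, true_and, Set.mem_prod, Set.mem_ofPred_eq,
      coe_univ, Set.mem_univ, and_true] at h ⊢
    exact ⟨hA f _ (fun i hi => by simp [hi]) h.1, hB f _ (fun i hi => by simp [hi]) h.2⟩
  · rintro ⟨f, g⟩ h
    simp only [coe_product, coe_filter, mem_univ, true_and, Set.mem_prod, Set.mem_ofPred_eq,
      coe_univ, Set.mem_univ, and_true] at h ⊢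
    exact ⟨hA f _ (fun i hi => by simp [hi]) h.1, hB g _ (fun i hi => by simp [hi]) h.2⟩
  · rintro ⟨f, g⟩ h
    ext i <;> by_cases hi : i ∈ T <;> simp [hi]
  · rintro ⟨f, g⟩ h
    ext i <;> by_cases hi : i ∈ T <;> simp [hi]

open Classical in
/-- A counting form of the Lovasz local lemma. -/
theorem local_lemma {I Q J : Type*} [Fintype I] [Fintype Q] [Nonempty Q] [Fintype J]
    (vbl : J → Finset I) (bad : J → (I → Q) → Prop)
    (hne : ∀ j, (vbl j).Nonempty)
    (hdep : ∀ j f g, (∀ i ∈ vbl j, f i = g i) → bad j f → bad j g)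
    (p : J → ℝ) (hp : ∀ j, (#{f : I → Q | bad j f} : ℝ) ≤ p j * Fintype.card (I → Q))
    (ρ : ℝ) (hρ : 0 < ρ)
    (hsum : ∀ i, ∑ j with i ∈ vbl j, p j * (ρ⁻¹) ^ (#(vbl j) - 1) ≤ 1 - ρ) :
    ∃ f : I → Q, ∀ j, ¬ bad j f := by
  set good : Finset I → (I → Q) → Prop := fun S f => ∀ j, vbl j ⊆ S → ¬ bad j f with hgood
  set a : Finset I → ℝ := fun S => (#{f : I → Q | good S f} : ℝ) with ha
  have hN : (0 : ℝ) < Fintype.card (I → Q) := by exact_mod_cast Fintype.card_pos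
  have hp0 : ∀ j, 0 ≤ p j := by
    intro j
    have := (Nat.cast_nonneg (α := ℝ) _).trans (hp j)
    exact nonneg_of_mul_nonneg_left this hN
  have hmono : ∀ S S', S ⊆ S' → ∀ f, good S' f → good S f :=
    fun S S' h f hf j hj => hf j (hj.trans h)
  -- main step
  have key : ∀ n, ∀ S : Finset I, #S = n → ∀ i ∉ S, ρ * a S ≤ a (insert i S) := by
    intro n
    induction n using Nat.strong_induction_on with
    | _ n ih =>
    intro S hS i hi
    -- iterated removal
    have rem : ∀ T : Finset I, T ⊆ S → a (S \ T) ≤ (ρ⁻¹) ^ (#T) * a S := by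
      intro T
      induction T using Finset.induction_on with
      | empty => intro _; simp
      | insert t T ht iht =>
        intro hT
        have hT' : T ⊆ S := (Finset.subset_insert t T).trans hT
        have htS : t ∈ S := hT (Finset.mem_insert_self _ _)
        have h1 := iht hT'
        have hlt : #(S \ insert t T) < n := by
          rw [← hS]
          apply Finset.card_lt_card
          refine ⟨Finset.sdiff_subset, fun h => ?_⟩
          have := h htS
          simp at this
        have h2 := ih _ hlt (S \ insert t T) rfl t (by simp)
        have h3 : insert t (S \ insert t T) = S \ T := by
          ext x
          simp only [Finset.mem_insert, Finset.mem_sdiff, not_or]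
          by_cases hx : x = t
          · subst hx; simp [ht, htS]
          · simp [hx]
        rw [h3] at h2
        rw [Finset.card_insert_of_notMem ht, pow_succ]
        have h4 : a (S \ insert t T) ≤ ρ⁻¹ * a (S \ T) := by
          rw [← div_eq_inv_mul, le_div_iff₀ hρ]; linarith
        calc _ ≤ ρ⁻¹ * a (S \ T) := h4
          _ ≤ ρ⁻¹ * ((ρ⁻¹) ^ (#T) * a S) := by gcongr
          _ = _ := by ring
    -- each bad event
    have each : ∀ j, i ∈ vbl j → vbl j ⊆ insert i S →
        (#{f : I → Q | good S f ∧ bad j f} : ℝ) ≤ p j * (ρ⁻¹) ^ (#(vbl j) - 1) * a S := by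
      intro j hij hj
      have hsub : (#{f : I → Q | good S f ∧ bad j f} : ℝ)
          ≤ #{f : I → Q | good (S \ vbl j) f ∧ bad j f} := by
        norm_cast
        apply Finset.card_le_card
        intro f
        simp only [Finset.mem_filter, Finset.mem_univ, true_and]
        exact fun h => ⟨hmono _ _ Finset.sdiff_subset f h.1, h.2⟩
      have hind := indep_count (good (S \ vbl j)) (bad j) (vbl j)
        (fun f g hfg hf j' hj' hb => hf j' hj' (hdep j' g f (fun x hx => by
          have := hj' hx
          simp only [Finset.mem_sdiff] at this
          exact (hfg x this.2).symm) hb)) (hdep j)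
      have hind' : (#{f : I → Q | good (S \ vbl j) f ∧ bad j f} : ℝ) * Fintype.card (I → Q)
          = a (S \ vbl j) * #{f : I → Q | bad j f} := by
        have h0 := congrArg (Nat.cast (R := ℝ)) hind
        push_cast at h0
        simp only [ha]
        convert h0 <;> rfl
      have h5 : (#{f : I → Q | good (S \ vbl j) f ∧ bad j f} : ℝ) ≤ a (S \ vbl j) * p j := by
        have h6 : (#{f : I → Q | good (S \ vbl j) f ∧ bad j f} : ℝ) * Fintype.card (I → Q)
          ≤ a (S \ vbl j) * p j * Fintype.card (I → Q) := by
          rw [hind', mul_assoc]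
          exact mul_le_mul_of_nonneg_left (hp j) (Nat.cast_nonneg _)
        exact le_of_mul_le_mul_right h6 hN
      have h7 : S \ vbl j = S \ ((vbl j).erase i) := by
        ext x
        simp only [Finset.mem_sdiff, Finset.mem_erase, not_and]
        constructor
        · rintro ⟨h, h'⟩; exact ⟨h, fun _ => h'⟩
        · rintro ⟨h, h'⟩; exact ⟨h, h' (fun hh => hi (hh ▸ h))⟩
      have h8 := rem ((vbl j).erase i) (by
        intro x hx
        rw [Finset.mem_erase] at hx
        have := hj hx.2
        rw [Finset.mem_insert] at this
        exact this.resolve_left hx.1)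
      rw [← h7, Finset.card_erase_of_mem hij] at h8
      calc _ ≤ _ := hsub
        _ ≤ _ := h5
        _ ≤ ((ρ⁻¹) ^ (#(vbl j) - 1) * a S) * p j := mul_le_mul_of_nonneg_right h8 (hp0 j)
        _ = _ := by ring
    have hcover : a S ≤ a (insert i S) +
        ∑ j with i ∈ vbl j, p j * (ρ⁻¹) ^ (#(vbl j) - 1) * a S := by
      have h1 : ({f : I → Q | good S f} : Finset (I → Q)) ⊆
          ({f : I → Q | good (insert i S) f} : Finset (I → Q)) ∪
          ({j : J | i ∈ vbl j ∧ vbl j ⊆ insert i S} : Finset J).biUnion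
            (fun j => {f : I → Q | good S f ∧ bad j f}) := by
        intro f
        simp only [Finset.mem_filter, Finset.mem_univ, true_and, Finset.mem_union,
          Finset.mem_biUnion]
        intro hf
        by_cases h : good (insert i S) f
        · exact Or.inl h
        · right
          simp only [hgood, not_forall, not_not] at h
          obtain ⟨j, hj, hb⟩ := h
          refine ⟨j, ⟨?_, hj⟩, hf, hb⟩
          by_contra hij
          refine hf j (fun x hx => ?_) hb
          have := hj hx
          rw [Finset.mem_insert] at this
          exact this.resolve_left (fun h => hij (h ▸ hx))
      have h2 := (Finset.card_le_card h1).trans (Finset.card_union_le _ _)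
      have h3 := h2.trans (Nat.add_le_add_left Finset.card_biUnion_le _)
      have h4 : a S ≤ a (insert i S) + ∑ j with (i ∈ vbl j ∧ vbl j ⊆ insert i S),
          (#{f : I → Q | good S f ∧ bad j f} : ℝ) := by
        simp only [ha]; exact_mod_cast h3
      refine h4.trans ?_
      gcongr
      calc _ ≤ ∑ j with (i ∈ vbl j ∧ vbl j ⊆ insert i S), p j * (ρ⁻¹) ^ (#(vbl j) - 1) * a S := by
            apply Finset.sum_le_sum
            intro j hj
            simp only [Finset.mem_filter, Finset.mem_univ, true_and] at hj
            exact each j hj.1 hj.2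
        _ ≤ _ := by
            apply Finset.sum_le_sum_of_subset_of_nonneg
            · intro j; simp only [Finset.mem_filter, Finset.mem_univ, true_and]; exact fun h => h.1
            · intro j _ _
              exact mul_nonneg (mul_nonneg (hp0 j) (by positivity)) (Nat.cast_nonneg _)
    rw [← Finset.sum_mul] at hcover
    have h9 := mul_le_mul_of_nonneg_right (hsum i) (Nat.cast_nonneg (α := ℝ) #{f : I → Q | good S f})
    change _ ≤ (1 - ρ) * a S at h9
    change _ * a S ≤ _ at h9
    linarith
  have hpos : ∀ S : Finset I, 0 < a S := by
    intro S
    induction S using Finset.induction_on with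
    | empty =>
      have : a ∅ = Fintype.card (I → Q) := by
        simp only [ha]
        norm_cast
        rw [← Finset.card_univ]
        congr 1
        ext f
        simp only [Finset.mem_filter, Finset.mem_univ, true_and, iff_true]
        intro j hj
        exact absurd (Finset.subset_empty.mp hj) (hne j).ne_empty
      rw [this]; exact hN
    | insert i S hi ihS =>
      exact lt_of_lt_of_le (mul_pos hρ ihS) (key _ S rfl i hi)
  have := hpos Finset.univ
  simp only [ha] at this
  have h2 : 0 < #{f : I → Q | good Finset.univ f} := by exact_mod_cast this
  obtain ⟨f, hf⟩ := Finset.card_pos.mp h2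
  simp only [Finset.mem_filter, Finset.mem_univ, true_and] at hf
  exact ⟨f, fun j => hf j (Finset.subset_univ _)⟩

open Finset

/-- vertex form of properness -/
def PC {V : Type*} (G : SimpleGraph V) (ψ : Sym2 V → ℕ) : Prop :=
  ∀ v u w, G.Adj v u → G.Adj v w → u ≠ w → ψ s(v, u) ≠ ψ s(v, w)

/-- color `c` is missing at `v` -/
def Miss {V : Type*} (G : SimpleGraph V) (ψ : Sym2 V → ℕ) (v : V) (c : ℕ) : Prop :=
  ∀ u, G.Adj v u → ψ s(v, u) ≠ c

/-- the two-colored subgraph -/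
def HH {V : Type*} (G : SimpleGraph V) (ψ : Sym2 V → ℕ) (γ δ : ℕ) : SimpleGraph V where
  Adj u v := G.Adj u v ∧ (ψ s(u, v) = γ ∨ ψ s(u, v) = δ)
  symm := ⟨fun u v h => ⟨h.1.symm, by rw [Sym2.eq_swap]; exact h.2⟩⟩
  loopless := ⟨fun u h => h.1.ne rfl⟩

open Classical in
/-- Kempe swap -/
noncomputable def kswap {V : Type*} (G : SimpleGraph V) (ψ : Sym2 V → ℕ) (γ δ : ℕ) (x : V) :
    Sym2 V → ℕ :=
  fun e => if ∃ v ∈ e, (HH G ψ γ δ).Reachable x v then Equiv.swap γ δ (ψ e) else ψ e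

section
variable {V : Type*} {G : SimpleGraph V} {ψ : Sym2 V → ℕ} {γ δ : ℕ} {x : V}

lemma kswap_in {v u : V} (hv : (HH G ψ γ δ).Reachable x v) :
    kswap G ψ γ δ x s(v, u) = Equiv.swap γ δ (ψ s(v, u)) := by
  unfold kswap
  rw [if_pos ⟨v, by simp, hv⟩]

lemma kswap_other {e : Sym2 V} (h1 : ψ e ≠ γ) (h2 : ψ e ≠ δ) : kswap G ψ γ δ x e = ψ e := by
  unfold kswap
  split_ifs
  · exact Equiv.swap_apply_of_ne_of_ne h1 h2
  · rfl

lemma kswap_out {v u : V} (hv : ¬ (HH G ψ γ δ).Reachable x v) (h : G.Adj v u) :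
    kswap G ψ γ δ x s(v, u) = ψ s(v, u) := by
  by_cases hc : ψ s(v, u) = γ ∨ ψ s(v, u) = δ
  · unfold kswap
    rw [if_neg]
    rintro ⟨w, hw, hr⟩
    rw [Sym2.mem_iff] at hw
    rcases hw with rfl | rfl
    · exact hv hr
    · apply hv
      refine hr.trans (SimpleGraph.Adj.reachable ?_)
      exact ⟨h.symm, by rw [Sym2.eq_swap]; exact hc⟩
  · push Not at hc
    exact kswap_other hc.1 hc.2

lemma kswap_mem {A : Finset ℕ} {e : Sym2 V} (hγ : γ ∈ A) (hδ : δ ∈ A) (h : ψ e ∈ A) :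
    kswap G ψ γ δ x e ∈ A := by
  unfold kswap
  split_ifs
  · rw [Equiv.swap_apply_def]; split_ifs <;> assumption
  · exact h

/-- membership in the pair of swapped colors is preserved -/
lemma kswap_iff {e : Sym2 V} :
    (kswap G ψ γ δ x e = γ ∨ kswap G ψ γ δ x e = δ) ↔ (ψ e = γ ∨ ψ e = δ) := by
  unfold kswap
  split_ifs
  · rw [Equiv.swap_apply_def]; split_ifs <;> simp_all
  · rfl

lemma PC.kswap (h : PC G ψ) : PC G (kswap G ψ γ δ x) := by
  intro v u w hu hw huw
  by_cases hv : (HH G ψ γ δ).Reachable x v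
  · rw [kswap_in hv, kswap_in hv]
    exact fun e => h v u w hu hw huw ((Equiv.swap γ δ).injective e)
  · rw [kswap_out hv hu, kswap_out hv hw]
    exact h v u w hu hw huw

lemma miss_kswap_in {v : V} {c : ℕ} (hv : (HH G ψ γ δ).Reachable x v) :
    Miss G (kswap G ψ γ δ x) v c ↔ Miss G ψ v (Equiv.swap γ δ c) := by
  unfold Miss
  refine forall_congr' fun u => forall_congr' fun hu => ?_
  rw [kswap_in hv, ne_eq, ne_eq, Equiv.swap_apply_eq_iff]

lemma miss_kswap_out {v : V} {c : ℕ} (hv : ¬ (HH G ψ γ δ).Reachable x v) :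
    Miss G (kswap G ψ γ δ x) v c ↔ Miss G ψ v c := by
  unfold Miss
  refine forall_congr' fun u => forall_congr' fun hu => ?_
  rw [kswap_out hv hu]

lemma miss_kswap_other {v : V} {c : ℕ} (h1 : c ≠ γ) (h2 : c ≠ δ) :
    Miss G (kswap G ψ γ δ x) v c ↔ Miss G ψ v c := by
  by_cases hv : (HH G ψ γ δ).Reachable x v
  · rw [miss_kswap_in hv, Equiv.swap_apply_of_ne_of_ne h1 h2]
  · exact miss_kswap_out hv

open Classical in
/-- three vertices missing `γ` or `δ` are not all in one component -/
lemma three_not_comp [Fintype V] (hψ : PC G ψ) {a b c : V} (hab : a ≠ b) (hac : a ≠ c) (hbc : b ≠ c)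
    (ha : Miss G ψ a γ ∨ Miss G ψ a δ) (hb : Miss G ψ b γ ∨ Miss G ψ b δ)
    (hc : Miss G ψ c γ ∨ Miss G ψ c δ) :
    ¬ ((HH G ψ γ δ).Reachable a b ∧ (HH G ψ γ δ).Reachable a c) := by
  rintro ⟨rab, rac⟩
  set H := HH G ψ γ δ with hH
  set C := H.connectedComponentMk a with hC
  have hconn : (C.toSimpleGraph).Connected := C.connected_toSimpleGraph
  have h1 := hconn.card_vert_le_card_edgeSet_add_one
  rw [Nat.card_eq_fintype_card, Nat.card_eq_fintype_card, ← SimpleGraph.edgeFinset_card] at h1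
  have h2 := C.toSimpleGraph.sum_degrees_eq_twice_card_edges
  let a' : C := ⟨a, SimpleGraph.ConnectedComponent.connectedComponentMk_mem⟩
  have memC : ∀ v, H.Reachable a v → v ∈ C.supp := by
    intro v hv
    rw [SimpleGraph.ConnectedComponent.mem_supp_iff]
    exact (SimpleGraph.ConnectedComponent.eq.mpr hv).symm
  let b' : C := ⟨b, memC b rab⟩
  let c' : C := ⟨c, memC c rac⟩
  have hd2 : ∀ v : C, C.toSimpleGraph.degree v ≤ 2 := by
    intro v
    have : #(C.toSimpleGraph.neighborFinset v) ≤ #({γ, δ} : Finset ℕ) := by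
      apply Finset.card_le_card_of_injOn (fun u => ψ s(v.1, u.1))
      · intro u hu
        simp only [SimpleGraph.coe_neighborFinset, SimpleGraph.mem_neighborSet] at hu
        have : H.Adj v.1 u.1 := hu
        simpa using this.2
      · intro u hu w hw huw
        simp only [SimpleGraph.coe_neighborFinset, SimpleGraph.mem_neighborSet] at hu hw
        have h1 : H.Adj v.1 u.1 := hu
        have h2 : H.Adj v.1 w.1 := hw
        by_contra hne
        exact hψ v.1 u.1 w.1 h1.1 h2.1 (fun h => hne (Subtype.ext h)) huw
    exact this.trans Finset.card_le_two
  have hd1 : ∀ v : C, (Miss G ψ v.1 γ ∨ Miss G ψ v.1 δ) → C.toSimpleGraph.degree v ≤ 1 := by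
    intro v hm
    rw [← SimpleGraph.card_neighborFinset_eq_degree]
    rw [Finset.card_le_one]
    intro u hu w hw
    simp only [SimpleGraph.mem_neighborFinset] at hu hw
    have h1 : H.Adj v.1 u.1 := hu
    have h2 : H.Adj v.1 w.1 := hw
    by_contra hne
    have h3 := hψ v.1 u.1 w.1 h1.1 h2.1 (fun h => hne (Subtype.ext h))
    have h4 := h1.2
    have h5 := h2.2
    rcases hm with hm | hm
    · have := hm _ h1.1; have := hm _ h2.1; grind
    · have := hm _ h1.1; have := hm _ h2.1; grind
  have hs : ∑ v : C, (C.toSimpleGraph.degree v + (if v ∈ ({a', b', c'} : Finset C) then 1 else 0))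
      ≤ ∑ v : C, 2 := by
    apply Finset.sum_le_sum
    intro v _
    split_ifs with h
    · have : Miss G ψ v.1 γ ∨ Miss G ψ v.1 δ := by
        simp only [Finset.mem_insert, Finset.mem_singleton] at h
        rcases h with rfl | rfl | rfl <;> assumption
      have := hd1 v this
      omega
    · exact hd2 v
  have h3 : #({a', b', c'} : Finset C) = 3 := by
    rw [Finset.card_eq_three]
    exact ⟨a', b', c', by simpa [a', b'] using hab, by simpa [a', c'] using hac,
      by simpa [b', c'] using hbc, rfl⟩
  rw [Finset.sum_add_distrib, h2, Finset.sum_ite_mem, Finset.univ_inter, Finset.sum_const,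
    Finset.sum_const, h3, Finset.card_univ] at hs
  simp only [smul_eq_mul] at hs
  have h5 : Fintype.card C ≤ #C.toSimpleGraph.edgeFinset + 1 := by convert h1
  omega
end

open Finset

/-- delete all edges at `v` -/
def dv {V : Type*} (G : SimpleGraph V) (v : V) : SimpleGraph V where
  Adj a b := G.Adj a b ∧ a ≠ v ∧ b ≠ v
  symm := ⟨fun _ _ h => ⟨h.1.symm, h.2.2, h.2.1⟩⟩
  loopless := ⟨fun _ h => h.1.ne rfl⟩

/-- delete the edges in `B` -/
def dB {V : Type*} (G : SimpleGraph V) (B : Sym2 V → Prop) : SimpleGraph V where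
  Adj a b := G.Adj a b ∧ ¬ B s(a, b)
  symm := ⟨fun _ _ h => ⟨h.1.symm, by rw [Sym2.eq_swap]; exact h.2⟩⟩
  loopless := ⟨fun _ h => h.1.ne rfl⟩

/-- colors are from `A` -/
def From {V : Type*} (G : SimpleGraph V) (ψ : Sym2 V → ℕ) (A : Finset ℕ) : Prop :=
  ∀ a b, G.Adj a b → ψ s(a, b) ∈ A

section
variable {V : Type*} [Fintype V]

open Classical in
/-- A configuration: a coloring with sets of missing colors at the neighbors of `v`. -/
structure Conf (G : SimpleGraph V) (v s : V) (A : Finset ℕ) (ψ : Sym2 V → ℕ)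
    (M : V → Finset ℕ) : Prop where
  pc : PC (dv G v) ψ
  fr : From (dv G v) ψ A
  sub : ∀ u, G.Adj v u → M u ⊆ A
  miss : ∀ u, G.Adj v u → ∀ c ∈ M u, Miss (dv G v) ψ u c
  card : ∀ u, G.Adj v u → #(M u) = if u = s then 1 else 2

open Classical in
/-- neighbors whose set contains `i` -/
noncomputable def XX (G : SimpleGraph V) (v : V) (M : V → Finset ℕ) (i : ℕ) : Finset V :=
  (G.neighborFinset v).filter (fun u => i ∈ M u)

open Classical in
lemma conf_sum {G : SimpleGraph V} {v s : V} {A : Finset ℕ} {ψ : Sym2 V → ℕ} {M : V → Finset ℕ}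
    (h : Conf G v s A ψ M) (hs : G.Adj v s) :
    ∑ i ∈ A, #(XX G v M i) + 1 = 2 * G.degree v := by
  have h1 : ∑ i ∈ A, #(XX G v M i) = ∑ u ∈ G.neighborFinset v, #(M u) := by
    unfold XX
    simp_rw [Finset.card_filter]
    rw [Finset.sum_comm]
    apply Finset.sum_congr rfl
    intro u hu
    rw [← Finset.card_filter]
    congr 1
    rw [Finset.filter_mem_eq_inter]
    exact Finset.inter_eq_right.mpr (h.sub u (by simpa using hu))
  have h2 : ∑ u ∈ G.neighborFinset v, (#(M u) + if u = s then 1 else 0) =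
      ∑ u ∈ G.neighborFinset v, 2 := by
    apply Finset.sum_congr rfl
    intro u hu
    rw [h.card u (by simpa using hu)]
    split_ifs <;> rfl
  rw [Finset.sum_add_distrib, Finset.sum_ite_eq', if_pos (by simpa using hs), ← h1,
    Finset.sum_const, SimpleGraph.card_neighborFinset_eq_degree] at h2
  rw [h2]; simp [mul_comm]

open Classical in
lemma conf_improve {G : SimpleGraph V} {v s : V} {A : Finset ℕ} (hs : G.Adj v s)
    (hd : G.degree v ≤ #A) : ∀ n, ∀ ψ M, Conf G v s A ψ M → #{j ∈ A | XX G v M j = ∅} = n →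
    ∃ ψ M, Conf G v s A ψ M ∧ ∃ i ∈ A, #(XX G v M i) = 1 := by
  intro n
  induction n using Nat.strong_induction_on with
  | _ n ih =>
  intro ψ M h hn
  by_cases h1 : ∃ i ∈ A, #(XX G v M i) = 1
  · exact ⟨ψ, M, h, h1⟩
  push Not at h1
  have hsum := conf_sum h hs
  -- an odd class
  obtain ⟨i, hiA, hi⟩ : ∃ i ∈ A, Odd #(XX G v M i) := by
    by_contra hcon
    push Not at hcon
    have : Even (∑ i ∈ A, #(XX G v M i)) := by
      apply Finset.even_sum
      intro i hi
      exact Nat.not_odd_iff_even.mp (hcon i hi)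
    obtain ⟨r, hr⟩ := this
    omega
  have hi3 : 3 ≤ #(XX G v M i) := by
    obtain ⟨r, hr⟩ := hi
    have := h1 i hiA
    omega
  -- an empty class
  obtain ⟨j, hjA, hj⟩ : ∃ j ∈ A, XX G v M j = ∅ := by
    by_contra hcon
    push Not at hcon
    have : ∑ i ∈ A, 2 ≤ ∑ i ∈ A, #(XX G v M i) := by
      apply Finset.sum_le_sum
      intro j hj
      have h2 := h1 j hj
      have h3 := Finset.card_pos.mpr (hcon j hj)
      omega
    rw [Finset.sum_const, smul_eq_mul] at this
    omega
  have hij : i ≠ j := by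
    rintro rfl
    rw [hj] at hi3
    simp at hi3
  obtain ⟨x, y, z, hx, hy, hz, hxy, hxz, hyz⟩ := Finset.two_lt_card_iff.mp (by omega : 2 < #(XX G v M i))
  have memX : ∀ M u c, u ∈ XX G v M c ↔ G.Adj v u ∧ c ∈ M u := by
    intro M u c; simp [XX]
  have hmissi : ∀ u ∈ XX G v M i, Miss (dv G v) ψ u i := by
    intro u hu
    rw [memX] at hu
    exact h.miss u hu.1 i hu.2
  have h3 := three_not_comp (γ := i) (δ := j) h.pc hxy hxz hyz (Or.inl (hmissi x hx))
    (Or.inl (hmissi y hy)) (Or.inl (hmissi z hz))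
  set R := HH (dv G v) ψ i j with hR
  obtain ⟨w, hw, hwn⟩ : ∃ w ∈ XX G v M i, ¬ R.Reachable x w := by
    by_contra hcon
    push Not at hcon
    exact h3 ⟨hcon y hy, hcon z hz⟩
  set M' : V → Finset ℕ := fun u => if R.Reachable x u then (M u).image (Equiv.swap i j) else M u
    with hM'
  have hconf : Conf G v s A (kswap (dv G v) ψ i j x) M' := by
    refine ⟨h.pc.kswap, fun a b hab => kswap_mem hiA hjA (h.fr a b hab), ?_, ?_, ?_⟩
    · intro u hu
      simp only [hM']
      split_ifs
      · intro c hc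
        obtain ⟨c', hc', rfl⟩ := Finset.mem_image.mp hc
        have := h.sub u hu hc'
        rw [Equiv.swap_apply_def]; split_ifs <;> assumption
      · exact h.sub u hu
    · intro u hu c hc
      simp only [hM'] at hc
      split_ifs at hc with hr
      · rw [miss_kswap_in hr]
        obtain ⟨c', hc', rfl⟩ := Finset.mem_image.mp hc
        rw [Equiv.swap_apply_self]
        exact h.miss u hu c' hc'
      · rw [miss_kswap_out hr]
        exact h.miss u hu c hc
    · intro u hu
      simp only [hM']
      rw [← h.card u hu]
      split_ifs with hr
      · exact Finset.card_image_of_injective _ (Equiv.swap i j).injective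
      · rfl
  refine ih _ ?_ _ M' hconf rfl
  rw [← hn]
  apply Finset.card_lt_card
  have hother : ∀ c, c ≠ i → c ≠ j → XX G v M' c = XX G v M c := by
    intro c hci hcj
    ext u
    rw [memX, memX]
    refine and_congr_right fun _ => ?_
    simp only [hM']
    split_ifs
    · rw [Finset.mem_image]
      constructor
      · rintro ⟨c', hc', hcc⟩
        have := Equiv.swap_apply_eq_iff.mp hcc
        rw [Equiv.swap_apply_of_ne_of_ne hci hcj] at this
        exact this ▸ hc'
      · intro hc
        exact ⟨c, hc, Equiv.swap_apply_of_ne_of_ne hci hcj⟩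
    · rfl
  have hi' : w ∈ XX G v M' i := by
    rw [memX] at hw ⊢
    simp only [hM', if_neg hwn]
    exact hw
  have hj' : x ∈ XX G v M' j := by
    rw [memX] at hx ⊢
    refine ⟨hx.1, ?_⟩
    simp only [hM', if_pos (SimpleGraph.Reachable.refl x)]
    exact Finset.mem_image.mpr ⟨i, hx.2, Equiv.swap_apply_left i j⟩
  refine (Finset.ssubset_iff_of_subset ?_).mpr ⟨j, by simp [hjA, hj], ?_⟩
  · intro c hc
    simp only [Finset.mem_filter] at hc ⊢
    refine ⟨hc.1, ?_⟩
    by_cases hci : c = i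
    · subst hci; rw [hc.2] at hi'; simp at hi'
    by_cases hcj : c = j
    · subst hcj; exact hj
    rw [← hother c hci hcj]; exact hc.2
  · simp only [Finset.mem_filter, not_and]
    intro _ he
    rw [he] at hj'; simp at hj'

open Classical in
lemma vizing_ext : ∀ k, ∀ A : Finset ℕ, #A = k → ∀ (G : SimpleGraph V) (v : V),
    G.degree v ≤ k → (∀ u, G.Adj v u → G.degree u ≤ k) →
    (∀ u w, G.Adj v u → G.Adj v w → G.degree u = k → G.degree w = k → u = w) →
    (∃ ψ, PC (dv G v) ψ ∧ From (dv G v) ψ A) → ∃ ψ, PC G ψ ∧ From G ψ A := by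
  intro k
  induction k with
  | zero =>
    rintro A hA G v hd - - ⟨ψ, h1, h2⟩
    have hno : ∀ a b, G.Adj a b → (dv G v).Adj a b := by
      intro a b hab
      have hz : ∀ u, ¬ G.Adj v u := by
        intro u hu
        have : 0 < G.degree v := G.degree_pos_iff_exists_adj v |>.mpr ⟨u, hu⟩
        omega
      exact ⟨hab, fun h => hz b (h ▸ hab), fun h => hz a (h ▸ hab.symm)⟩
    exact ⟨ψ, fun a b c hb hc => h1 a b c (hno _ _ hb) (hno _ _ hc), fun a b h => h2 a b (hno _ _ h)⟩
  | succ k ih =>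
    rintro A hA G v hd hdn huniq ⟨ψ, h1, h2⟩
    by_cases hN : ∀ u, ¬ G.Adj v u
    · have hno : ∀ a b, G.Adj a b → (dv G v).Adj a b := by
        intro a b hab
        exact ⟨hab, fun h => hN b (h ▸ hab), fun h => hN a (h ▸ hab.symm)⟩
      exact ⟨ψ, fun a b c hb hc => h1 a b c (hno _ _ hb) (hno _ _ hc),
        fun a b h => h2 a b (hno _ _ h)⟩
    push Not at hN
    obtain ⟨s, hs, hsu⟩ : ∃ s, G.Adj v s ∧ ∀ u, G.Adj v u → u ≠ s → G.degree u < k + 1 := by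
      by_cases h : ∃ s, G.Adj v s ∧ G.degree s = k + 1
      · obtain ⟨s, hs, hs'⟩ := h
        refine ⟨s, hs, fun u hu hus => lt_of_le_of_ne (hdn u hu) fun he => hus ?_⟩
        exact huniq u s hu hs he hs'
      · push Not at h
        obtain ⟨s, hs⟩ := hN
        exact ⟨s, hs, fun u hu _ => lt_of_le_of_ne (hdn u hu) (h u hu)⟩
    -- used colors
    have hM : ∀ u, ∃ M : Finset ℕ, G.Adj v u → M ⊆ A ∧ (∀ c ∈ M, Miss (dv G v) ψ u c) ∧
        #M = if u = s then 1 else 2 := by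
      intro u
      by_cases hu : G.Adj v u
      swap
      · exact ⟨∅, fun h => absurd h hu⟩
      set U : Finset ℕ := ((G.neighborFinset u).erase v).image (fun w => ψ s(u, w)) with hU
      have hUc : #U ≤ G.degree u - 1 := by
        refine Finset.card_image_le.trans ?_
        rw [Finset.card_erase_of_mem (by simpa using hu.symm),
          SimpleGraph.card_neighborFinset_eq_degree]
      have hpos : 0 < G.degree u := (G.degree_pos_iff_exists_adj u).mpr ⟨v, hu.symm⟩
      have hle : (if u = s then 1 else 2) ≤ #(A \ U) := by
        have := Finset.le_card_sdiff U A
        have h3 := hdn u hu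
        split_ifs with hus
        · omega
        · have := hsu u hu hus
          omega
      obtain ⟨M, hMs, hMc⟩ := Finset.exists_subset_card_eq hle
      refine ⟨M, fun _ => ⟨hMs.trans Finset.sdiff_subset, ?_, hMc⟩⟩
      intro c hc w hw he
      have := Finset.mem_sdiff.mp (hMs hc)
      apply this.2
      rw [hU, Finset.mem_image]
      exact ⟨w, by simp [hw.2.2, hw.1], he⟩
    choose M hM using hM
    have hconf : Conf G v s A ψ M := ⟨h1, h2, fun u hu => (hM u hu).1, fun u hu => (hM u hu).2.1,
      fun u hu => (hM u hu).2.2⟩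
    clear hM h1 h2
    obtain ⟨ψ, M, hc, i, hiA, hi⟩ := conf_improve hs (by omega) _ ψ M hconf rfl
    obtain ⟨u, hu⟩ := Finset.card_eq_one.mp hi
    have memX : ∀ u c, u ∈ XX G v M c ↔ G.Adj v u ∧ c ∈ M u := by
      intro u c; simp [XX]
    have huX : u ∈ XX G v M i := by rw [hu]; simp
    rw [memX] at huX
    obtain ⟨hvu, hiu⟩ := huX
    have hother : ∀ w, G.Adj v w → w ≠ u → i ∉ M w := by
      intro w hw hwu hiw
      have : w ∈ XX G v M i := (memX w i).mpr ⟨hw, hiw⟩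
      rw [hu] at this
      exact hwu (by simpa using this)
    set B : Sym2 V → Prop := fun e => e = s(v, u) ∨ (v ∉ e ∧ ψ e = i) with hB
    set G' : SimpleGraph V := dB G B with hG'
    have hdvu : G'.degree v ≤ k := by
      have : G'.neighborFinset v ⊆ (G.neighborFinset v).erase u := by
        intro w hw
        simp only [SimpleGraph.mem_neighborFinset, Finset.mem_erase] at hw ⊢
        refine ⟨?_, hw.1⟩
        rintro rfl
        exact hw.2 (Or.inl rfl)
      have := Finset.card_le_card this
      rw [Finset.card_erase_of_mem (by simpa using hvu), SimpleGraph.card_neighborFinset_eq_degree,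
        SimpleGraph.card_neighborFinset_eq_degree] at this
      omega
    have hdw : ∀ w, G'.Adj v w → G'.degree w + #(M w) ≤ k + 1 := by
      intro w hw
      have hwu : w ≠ u := by
        rintro rfl
        exact hw.2 (Or.inl rfl)
      have h3 : #((G'.neighborFinset w).erase v) ≤ #(A \ insert i (M w)) := by
        apply Finset.card_le_card_of_injOn (fun z => ψ s(w, z))
        · intro z hz
          simp only [Finset.coe_erase, SimpleGraph.coe_neighborFinset, Set.mem_sdiff,
            SimpleGraph.mem_neighborSet, Set.mem_singleton_iff] at hz
          have hwz : (dv G v).Adj w z := ⟨hz.1.1, hw.1.ne', hz.2⟩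
          simp only [Finset.coe_sdiff, Finset.coe_insert, Set.mem_sdiff, Finset.mem_coe,
            Set.mem_insert_iff, not_or]
          refine ⟨hc.fr _ _ hwz, ?_, fun h => hc.miss w hw.1 _ h z hwz rfl⟩
          intro h
          apply hz.1.2
          refine Or.inr ⟨?_, h⟩
          rw [Sym2.mem_iff]
          push Not
          exact ⟨hw.1.ne, fun h => hz.2 h.symm⟩
        · intro z hz z' hz' hzz
          simp only [Finset.coe_erase, SimpleGraph.coe_neighborFinset, Set.mem_sdiff,
            SimpleGraph.mem_neighborSet, Set.mem_singleton_iff] at hz hz'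
          by_contra hne
          exact hc.pc w z z' ⟨hz.1.1, hw.1.ne', hz.2⟩ ⟨hz'.1.1, hw.1.ne', hz'.2⟩ hne hzz
      have h4 : insert i (M w) ⊆ A := by
        intro c hcc
        rw [Finset.mem_insert] at hcc
        rcases hcc with rfl | hcc
        · exact hiA
        · exact hc.sub w hw.1 hcc
      rw [Finset.card_sdiff_of_subset h4, Finset.card_insert_of_notMem (hother w hw.1 hwu),
        Finset.card_erase_of_mem (by simpa using hw.symm),
        SimpleGraph.card_neighborFinset_eq_degree] at h3
      have h5 := Finset.card_le_card h4
      rw [Finset.card_insert_of_notMem (hother w hw.1 hwu)] at h5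
      have hpos : 0 < G'.degree w := (G'.degree_pos_iff_exists_adj w).mpr ⟨v, hw.symm⟩
      omega
    have hMw : ∀ w, G'.Adj v w → #(M w) = if w = s then 1 else 2 := fun w hw => hc.card w hw.1
    obtain ⟨φ, hφ1, hφ2⟩ := ih (A.erase i) (by rw [Finset.card_erase_of_mem hiA, hA]; rfl) G' v hdvu
      (by
        intro w hw
        have := hdw w hw
        have h6 := hMw w hw
        split_ifs at h6 <;> omega)
      (by
        have : ∀ w, G'.Adj v w → G'.degree w = k → w = s := by
          intro w hw hk
          by_contra hws
          have := hdw w hw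
          have h6 := hMw w hw
          rw [if_neg hws] at h6
          omega
        intro w w' hw hw' hk hk'
        rw [this w hw hk, this w' hw' hk'])
      ⟨ψ, fun a b c hb hc' hbc => hc.pc a b c ⟨hb.1.1, hb.2⟩ ⟨hc'.1.1, hc'.2⟩ hbc, by
        intro a b hab
        rw [Finset.mem_erase]
        refine ⟨fun h => hab.1.2 (Or.inr ⟨?_, h⟩), hc.fr a b ⟨hab.1.1, hab.2⟩⟩
        rw [Sym2.mem_iff]
        push Not
        exact ⟨hab.2.1.symm, hab.2.2.symm⟩⟩
    have hbad : ∀ a b c, G.Adj a b → G.Adj a c → b ≠ c → B s(a, b) → B s(a, c) → False := by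
      intro a b c hb hc' hbc hB1 hB2
      have hdvm : ∀ p q, G.Adj p q → v ∉ s(p, q) → (dv G v).Adj p q := by
        intro p q hpq hv
        rw [Sym2.mem_iff] at hv
        push Not at hv
        exact ⟨hpq, hv.1.symm, hv.2.symm⟩
      have hmix : ∀ b c, G.Adj a b → G.Adj a c → s(a, b) = s(v, u) → v ∉ s(a, c) → ψ s(a, c) = i →
          False := by
        intro b c hb hc' he hv hcol
        have := hdvm _ _ hc' hv
        rcases Sym2.eq_iff.mp he with ⟨rfl, rfl⟩ | ⟨rfl, rfl⟩
        · exact hv (by simp)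
        · exact hc.miss _ hvu i hiu c this hcol
      rcases hB1 with e1 | ⟨e1, e1'⟩ <;> rcases hB2 with e2 | ⟨e2, e2'⟩
      · rw [← e2] at e1
        exact hbc (Sym2.congr_right.mp e1)
      · exact hmix b c hb hc' e1 e2 e2'
      · exact hmix c b hc' hb e2 e1 e1'
      · exact hc.pc a b c (hdvm _ _ hb e1) (hdvm _ _ hc' e2) hbc (e1'.trans e2'.symm)
    refine ⟨fun e => if B e then i else φ e, ?_, ?_⟩
    · intro a b c hb hc' hbc
      have hni : ∀ a b, G.Adj a b → ¬ B s(a, b) → φ s(a, b) ≠ i := by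
        intro a b hab hn
        exact (Finset.mem_erase.mp (hφ2 a b ⟨hab, hn⟩)).1
      by_cases hB1 : B s(a, b) <;> by_cases hB2 : B s(a, c)
      · exact (hbad a b c hb hc' hbc hB1 hB2).elim
      · simp only [if_pos hB1, if_neg hB2]
        exact (hni _ _ hc' hB2).symm
      · simp only [if_pos hB2, if_neg hB1]
        exact (hni _ _ hb hB1)
      · simp only [if_neg hB1, if_neg hB2]
        exact hφ1 a b c ⟨hb, hB1⟩ ⟨hc', hB2⟩ hbc
    · intro a b hab
      by_cases hB1 : B s(a, b)
      · simp only [if_pos hB1]; exact hiA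
      · simp only [if_neg hB1]
        exact Finset.mem_of_mem_erase (hφ2 a b ⟨hab, hB1⟩)

open Classical in
/-- Vizing theorem -/
theorem vizing (G : SimpleGraph V) (D : ℕ) (hD : ∀ v, G.degree v ≤ D) :
    ∃ ψ, PC G ψ ∧ ∀ a b, G.Adj a b → ψ s(a, b) < D + 1 := by
  have key : ∀ S : Finset V, ∀ G : SimpleGraph V, (∀ v, G.degree v ≤ D) →
      (∀ a b, G.Adj a b → a ∈ S) → ∃ ψ, PC G ψ ∧ From G ψ (Finset.range (D + 1)) := by
    intro S
    induction S using Finset.induction_on with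
    | empty =>
      intro G _ hS
      exact ⟨fun _ => 0, fun a b c h => absurd (hS a b h) (by simp),
        fun a b h => absurd (hS a b h) (by simp)⟩
    | insert v S hv ih =>
      intro G hG hS
      refine vizing_ext (D + 1) _ (by simp) G v ((hG v).trans (Nat.le_succ _))
        (fun u _ => (hG u).trans (Nat.le_succ _)) (fun u w _ _ h => ?_) (ih (dv G v) ?_ ?_)
      · have := hG u; omega
      · intro u
        refine le_trans ?_ (hG u)
        apply SimpleGraph.degree_le_of_le
        exact fun a b h => h.1
      · intro a b hab
        have := hS a b hab.1
        rw [Finset.mem_insert] at this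
        exact this.resolve_left hab.2.1
  obtain ⟨ψ, h1, h2⟩ := key Finset.univ G hD (by simp)
  exact ⟨ψ, h1, fun a b h => Finset.mem_range.mp (h2 a b h)⟩
end

open Finset

/-- every vertex of the two-colored component of `x` has both colors -/
def Full {V : Type*} (G : SimpleGraph V) (ψ : Sym2 V → ℕ) (c d : ℕ) (x : V) : Prop :=
  ∀ y, (HH G ψ c d).Reachable x y →
    (∃ u, G.Adj y u ∧ ψ s(y, u) = c) ∧ (∃ u, G.Adj y u ∧ ψ s(y, u) = d)

section
variable {V : Type*} [Fintype V]

open Classical in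
/-- vertices of the two-colored component of `x` -/
noncomputable def Comp (G : SimpleGraph V) (ψ : Sym2 V → ℕ) (c d : ℕ) (x : V) : Finset V :=
  {y : V | (HH G ψ c d).Reachable x y}

open Classical in
/-- edges of color `c` meeting `S` -/
noncomputable def FE (G : SimpleGraph V) (ψ : Sym2 V → ℕ) (c : ℕ) (S : Finset V) :
    Finset (Sym2 V) :=
  {e ∈ G.edgeFinset | ψ e = c ∧ ∃ y ∈ S, y ∈ e}

variable {G : SimpleGraph V} {ψ : Sym2 V → ℕ} {c d : ℕ}

lemma mem_Comp {x y : V} : y ∈ Comp G ψ c d x ↔ (HH G ψ c d).Reachable x y := by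
  simp [Comp]

lemma Comp_eq {x y : V} (h : (HH G ψ c d).Reachable x y) : Comp G ψ c d y = Comp G ψ c d x := by
  ext z
  rw [mem_Comp, mem_Comp]
  exact ⟨fun h' => h.trans h', fun h' => h.symm.trans h'⟩

lemma mem_FE {S : Finset V} {e : Sym2 V} :
    e ∈ FE G ψ c S ↔ e ∈ G.edgeSet ∧ ψ e = c ∧ ∃ y ∈ S, y ∈ e := by
  simp [FE]

open Classical in
lemma card_Comp (hψ : PC G ψ) {x : V} (hF : Full G ψ c d x) :
    #(Comp G ψ c d x) = 2 * #(FE G ψ c (Comp G ψ c d x)) := by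
  set S := Comp G ψ c d x with hS
  have h := Finset.sum_card_bipartiteAbove_eq_sum_card_bipartiteBelow (s := S)
    (t := FE G ψ c S) (fun (y : V) (e : Sym2 V) => y ∈ e)
  have h1 : ∀ y ∈ S, #(bipartiteAbove (fun (y : V) (e : Sym2 V) => y ∈ e) (FE G ψ c S) y) = 1 := by
    intro y hy
    obtain ⟨⟨u, hu, hc⟩, -⟩ := hF y (mem_Comp.mp hy)
    rw [Finset.card_eq_one]
    refine ⟨s(y, u), ?_⟩
    ext e
    simp only [bipartiteAbove, mem_filter, mem_FE, Finset.mem_singleton]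
    constructor
    · rintro ⟨⟨he, hec, -⟩, hye⟩
      obtain ⟨z, rfl⟩ := hye
      by_contra hne
      refine hψ y z u he hu (fun h => hne (by rw [h])) (hec.trans hc.symm)
    · rintro rfl
      exact ⟨⟨hu, hc, y, hy, by simp⟩, by simp⟩
  have h2 : ∀ e ∈ FE G ψ c S, #(bipartiteBelow (fun (y : V) (e : Sym2 V) => y ∈ e) S e) = 2 := by
    intro e he
    rw [mem_FE] at he
    obtain ⟨he, hec, y, hy, z, rfl⟩ := he
    have hyz : G.Adj y z := he
    have hz : z ∈ S := by
      rw [hS, mem_Comp] at hy ⊢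
      exact hy.trans (SimpleGraph.Adj.reachable ⟨hyz, Or.inl hec⟩)
    rw [Finset.card_eq_two]
    refine ⟨y, z, hyz.ne, ?_⟩
    ext a
    simp only [bipartiteBelow, mem_filter, Sym2.mem_iff, Finset.mem_insert, Finset.mem_singleton]
    constructor
    · exact fun h => h.2
    · rintro (rfl | rfl)
      · exact ⟨hy, Or.inl rfl⟩
      · exact ⟨hz, Or.inr rfl⟩
  rw [Finset.sum_congr rfl h1, Finset.sum_congr rfl h2] at h
  simpa [mul_comm] using h

open Classical in
lemma cycle_full (hψ : PC G ψ) {v : V} {w : G.Walk v v} (hw : w.IsCycle)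
    (hcol : ∀ e ∈ w.edges, ψ e = c ∨ ψ e = d) :
    c ≠ d ∧ Full G ψ c d v ∧ #(Comp G ψ c d v) = w.length ∧
      ∀ y ∈ Comp G ψ c d v, ∀ z, G.Adj y z → (ψ s(y, z) = c ∨ ψ s(y, z) = d) →
        s(y, z) ∈ w.edges := by
  have two : ∀ y ∈ w.support, ∃ u1 u2, u1 ≠ u2 ∧ s(y, u1) ∈ w.edges ∧ s(y, u2) ∈ w.edges := by
    intro y hy
    obtain ⟨u1, u2, hne, he⟩ := Set.ncard_eq_two.mp (hw.ncard_neighborSet_toSubgraph_eq_two hy)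
    refine ⟨u1, u2, hne, ?_, ?_⟩
    · rw [← SimpleGraph.Walk.adj_toSubgraph_iff_mem_edges]
      have : u1 ∈ w.toSubgraph.neighborSet y := by rw [he]; simp
      exact this
    · rw [← SimpleGraph.Walk.adj_toSubgraph_iff_mem_edges]
      have : u2 ∈ w.toSubgraph.neighborSet y := by rw [he]; simp
      exact this
  have adj : ∀ y z, s(y, z) ∈ w.edges → G.Adj y z := fun y z h => w.adj_of_mem_edges h
  have both : ∀ y ∈ w.support, c ≠ d ∧ (∃ u, s(y, u) ∈ w.edges ∧ ψ s(y, u) = c) ∧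
      (∃ u, s(y, u) ∈ w.edges ∧ ψ s(y, u) = d) := by
    intro y hy
    obtain ⟨u1, u2, hne, h1, h2⟩ := two y hy
    have h3 := hψ y u1 u2 (adj _ _ h1) (adj _ _ h2) hne
    rcases hcol _ h1 with h4 | h4 <;> rcases hcol _ h2 with h5 | h5
    · exact absurd (h4.trans h5.symm) h3
    · exact ⟨fun h => h3 (by rw [h4, h5, h]), ⟨u1, h1, h4⟩, ⟨u2, h2, h5⟩⟩
    · exact ⟨fun h => h3 (by rw [h4, h5, h]), ⟨u2, h2, h5⟩, ⟨u1, h1, h4⟩⟩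
    · exact absurd (h4.trans h5.symm) h3
  have closed : ∀ y ∈ w.support, ∀ z, G.Adj y z → (ψ s(y, z) = c ∨ ψ s(y, z) = d) →
      s(y, z) ∈ w.edges := by
    intro y hy z hz hcz
    obtain ⟨-, ⟨u1, h1, h1'⟩, ⟨u2, h2, h2'⟩⟩ := both y hy
    rcases hcz with h | h
    · by_cases hne : z = u1
      · rw [hne]; exact h1
      · exact absurd (h.trans h1'.symm) (hψ y z u1 hz (adj _ _ h1) hne)
    · by_cases hne : z = u2
      · rw [hne]; exact h2
      · exact absurd (h.trans h2'.symm) (hψ y z u2 hz (adj _ _ h2) hne)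
  have supp : ∀ y, (HH G ψ c d).Reachable v y ↔ y ∈ w.support := by
    intro y
    constructor
    · rw [SimpleGraph.reachable_iff_reflTransGen]
      intro h
      induction h with
      | refl => exact w.start_mem_support
      | tail _ hbc ih =>
        exact w.snd_mem_support_of_mem_edges (closed _ ih _ hbc.1 hbc.2)
    · intro hy
      have htr : ∀ e ∈ w.edges, e ∈ (HH G ψ c d).edgeSet := by
        intro e he
        have h1 := hcol e he
        have h2 := w.edges_subset_edgeSet he
        induction e with
        | _ a b => exact ⟨h2, h1⟩
      have h3 : y ∈ (w.transfer _ htr).support := by rw [SimpleGraph.Walk.support_transfer]; exact hy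
      exact ⟨(w.transfer _ htr).takeUntil y h3⟩
  refine ⟨(both v w.start_mem_support).1, ?_, ?_, ?_⟩
  · intro y hy
    obtain ⟨-, ⟨u1, h1, h1'⟩, ⟨u2, h2, h2'⟩⟩ := both y ((supp y).mp hy)
    exact ⟨⟨u1, adj _ _ h1, h1'⟩, ⟨u2, adj _ _ h2, h2'⟩⟩
  · have : Comp G ψ c d v = w.support.tail.toFinset := by
      ext y
      rw [mem_Comp, supp, List.mem_toFinset]
      constructor
      · intro hy
        rw [SimpleGraph.Walk.mem_support_iff] at hy
        rcases hy with rfl | hy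
        · exact SimpleGraph.Walk.end_mem_tail_support hw.not_nil
        · exact hy
      · exact List.mem_of_mem_tail
    rw [this, List.toFinset_card_of_nodup hw.support_nodup, List.length_tail,
      SimpleGraph.Walk.length_support]
    rfl
  · intro y hy
    exact closed y ((supp y).mp (mem_Comp.mp hy))
end

open Finset

section
variable {V : Type*} [Fintype V]

open Classical in
/-- number of edges colored 0 or 1 -/
noncomputable def low (G : SimpleGraph V) (ψ : Sym2 V → ℕ) : ℕ :=
  #{e ∈ G.edgeFinset | ψ e = 0 ∨ ψ e = 1}

/-- a proper coloring with minimal number of edges colored 0 or 1 -/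
structure LowMin (G : SimpleGraph V) (D : ℕ) (ψ : Sym2 V → ℕ) : Prop where
  pc : PC G ψ
  fr : From G ψ (Finset.range (D + 1))
  min : ∀ φ, PC G φ → From G φ (Finset.range (D + 1)) → low G ψ ≤ low G φ

variable {G : SimpleGraph V} {D : ℕ} {ψ : Sym2 V → ℕ}

/-- low colored adjacency -/
def LowAdj (G : SimpleGraph V) (ψ : Sym2 V → ℕ) (y z : V) : Prop :=
  G.Adj y z ∧ (ψ s(y, z) = 0 ∨ ψ s(y, z) = 1)

lemma kswap_low {γ δ : ℕ} (h1 : 2 ≤ γ) (h2 : 2 ≤ δ) (x : V) (e : Sym2 V) :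
    (kswap G ψ γ δ x e = 0 ∨ kswap G ψ γ δ x e = 1) ↔ (ψ e = 0 ∨ ψ e = 1) := by
  by_cases h : ψ e = γ ∨ ψ e = δ
  · have := (kswap_iff (G := G) (x := x)).mpr h
    omega
  · push Not at h
    rw [kswap_other h.1 h.2]

lemma LowMin.swap (h : LowMin G D ψ) {γ δ : ℕ} (h1 : 2 ≤ γ) (h2 : 2 ≤ δ) (h1' : γ < D + 1)
    (h2' : δ < D + 1) (x : V) : LowMin G D (kswap G ψ γ δ x) := by
  refine ⟨h.pc.kswap, fun a b hab => kswap_mem (by simpa using h1') (by simpa using h2') (h.fr a b hab), ?_⟩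
  intro φ hφ hφ'
  refine le_trans (le_of_eq ?_) (h.min φ hφ hφ')
  unfold low
  simp_rw [kswap_low h1 h2]

open Classical in
lemma low_one (h : LowMin G D ψ) {y z : V} (hyz : LowAdj G ψ y z) {γ : ℕ} (h1 : 2 ≤ γ)
    (h1' : γ < D + 1) (hy : Miss G ψ y γ) (hz : Miss G ψ z γ) : False := by
  set φ : Sym2 V → ℕ := fun e => if e = s(y, z) then γ else ψ e with hφ
  have hpc : PC G φ := by
    have key : ∀ v u w, G.Adj v u → G.Adj v w → u ≠ w → s(v, u) = s(y, z) → φ s(v, u) ≠ φ s(v, w) := by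
      intro v u w hu hw huw he
      have hne : s(v, w) ≠ s(y, z) := by
        rw [← he]; exact fun h => huw (Sym2.congr_right.mp h).symm
      simp only [hφ, if_pos he, if_neg hne]
      rcases Sym2.eq_iff.mp he with ⟨rfl, rfl⟩ | ⟨rfl, rfl⟩
      · exact (hy _ hw).symm
      · exact (hz _ hw).symm
    intro v u w hu hw huw
    by_cases e1 : s(v, u) = s(y, z)
    · exact key v u w hu hw huw e1
    by_cases e2 : s(v, w) = s(y, z)
    · exact (key v w u hw hu huw.symm e2).symm
    simp only [hφ, if_neg e1, if_neg e2]
    exact h.pc v u w hu hw huw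
  have hfr : From G φ (Finset.range (D + 1)) := by
    intro a b hab
    simp only [hφ]
    split_ifs
    · simpa using h1'
    · exact h.fr a b hab
  have := h.min φ hpc hfr
  apply absurd this
  rw [not_le]
  unfold low
  apply Finset.card_lt_card
  refine (Finset.ssubset_iff_of_subset ?_).mpr ⟨s(y, z), ?_, ?_⟩
  · intro e
    simp only [Finset.mem_filter, hφ]
    split_ifs
    · omega
    · exact id
  · rw [Finset.mem_filter, SimpleGraph.mem_edgeFinset]
    exact ⟨hyz.1, hyz.2⟩
  · simp only [Finset.mem_filter, hφ, if_true]
    omega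

lemma LowAdj.swap {y z : V} (h : LowAdj G ψ y z) {γ δ : ℕ} (h1 : 2 ≤ γ) (h2 : 2 ≤ δ) (x : V) :
    LowAdj G (kswap G ψ γ δ x) y z := ⟨h.1, (kswap_low h1 h2 x _).mpr h.2⟩

lemma LowAdj.symm {y z : V} (h : LowAdj G ψ y z) : LowAdj G ψ z y :=
  ⟨h.1.symm, by rw [Sym2.eq_swap]; exact h.2⟩

lemma low_two (h : LowMin G D ψ) {y z w : V} (hyz : LowAdj G ψ y z) (hzw : LowAdj G ψ z w)
    (hyw : y ≠ w) {γ δ : ℕ} (hγ : 2 ≤ γ) (hγ' : γ < D + 1) (hδ : 2 ≤ δ) (hδ' : δ < D + 1)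
    (hy : Miss G ψ y γ) (hw : Miss G ψ w γ) (hz : Miss G ψ z δ) : False := by
  have h3 := three_not_comp h.pc hyz.1.ne hyw hzw.1.ne (Or.inl hy : Miss G ψ y γ ∨ Miss G ψ y δ)
    (Or.inr hz) (Or.inl hw)
  by_cases hr : (HH G ψ γ δ).Reachable y z
  · have hr' : ¬ (HH G ψ γ δ).Reachable w z := fun h' => h3 ⟨hr, hr.trans h'.symm⟩
    refine low_one (h.swap hγ hδ hγ' hδ' w) (hzw.swap hγ hδ w) hδ hδ' ?_ ?_
    · rw [miss_kswap_out hr']; exact hz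
    · rw [miss_kswap_in (SimpleGraph.Reachable.refl w), Equiv.swap_apply_right]; exact hw
  · refine low_one (h.swap hγ hδ hγ' hδ' y) (hyz.swap hγ hδ y) hδ hδ' ?_ ?_
    · rw [miss_kswap_in (SimpleGraph.Reachable.refl y), Equiv.swap_apply_right]; exact hy
    · rw [miss_kswap_out hr]; exact hz

open Classical in
lemma low_full (h : LowMin G D ψ) (hD : D ≤ 4) (hdeg : ∀ v, G.degree v ≤ D) (x : V) :
    ¬ Full G ψ 0 1 x := by
  intro hF
  have hm : ∀ y, (HH G ψ 0 1).Reachable x y → ∃ γ, 2 ≤ γ ∧ γ < D + 1 ∧ Miss G ψ y γ := by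
    intro y hy
    obtain ⟨⟨u, hu, hu'⟩, ⟨w, hw, hw'⟩⟩ := hF y hy
    have h1 : #((G.neighborFinset y).image (fun u => ψ s(y, u))) < #(Finset.range (D + 1)) := by
      refine lt_of_le_of_lt Finset.card_image_le ?_
      rw [SimpleGraph.card_neighborFinset_eq_degree, Finset.card_range]
      exact Nat.lt_succ_of_le (hdeg y)
    obtain ⟨γ, hγ, hγ'⟩ := Finset.exists_mem_notMem_of_card_lt_card h1
    have hmiss : Miss G ψ y γ := by
      intro z hz he
      exact hγ' (Finset.mem_image.mpr ⟨z, by simpa using hz, he⟩)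
    have := hmiss u hu
    have := hmiss w hw
    exact ⟨γ, by omega, by simpa using hγ, hmiss⟩
  -- a path of four vertices
  have step : ∀ y, (HH G ψ 0 1).Reachable x y → ∀ u, LowAdj G ψ y u →
    (HH G ψ 0 1).Reachable x u := fun y hy u hu => hy.trans (SimpleGraph.Adj.reachable hu)
  have rx := SimpleGraph.Reachable.refl (G := HH G ψ 0 1) x
  obtain ⟨⟨a, ha, ha'⟩, ⟨b, hb, hb'⟩⟩ := hF x rx
  have la : LowAdj G ψ x a := ⟨ha, Or.inl ha'⟩
  have lb : LowAdj G ψ x b := ⟨hb, Or.inr hb'⟩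
  have ra := step x rx a la
  have rb := step x rx b lb
  obtain ⟨⟨e, he, he'⟩, -⟩ := hF b rb
  have le : LowAdj G ψ b e := ⟨he, Or.inl he'⟩
  have re := step b rb e le
  have hab : a ≠ b := by rintro rfl; omega
  have hxe : x ≠ e := by
    rintro rfl
    rw [Sym2.eq_swap] at he'; omega
  have hae : a ≠ e := by
    rintro rfl
    refine h.pc a x b ha.symm he.symm hb.ne ?_
    rw [Sym2.eq_swap, ha', Sym2.eq_swap, he']
  obtain ⟨g1, h1, h1', m1⟩ := hm a ra
  obtain ⟨g2, h2, h2', m2⟩ := hm x rx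
  obtain ⟨g3, h3, h3', m3⟩ := hm b rb
  obtain ⟨g4, h4, h4', m4⟩ := hm e re
  have n12 : g1 ≠ g2 := by rintro rfl; exact low_one h la h1 h1' m2 m1
  have n23 : g2 ≠ g3 := by rintro rfl; exact low_one h lb h2 h2' m2 m3
  have n34 : g3 ≠ g4 := by rintro rfl; exact low_one h le h3 h3' m3 m4
  have n13 : g1 ≠ g3 := by rintro rfl; exact low_two h la.symm lb hab h1 h1' h2 h2' m1 m3 m2
  have n24 : g2 ≠ g4 := by rintro rfl; exact low_two h lb le hxe h2 h2' h3 h3' m2 m4 m3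
  have e14 : g4 = g1 := by omega
  subst e14
  have hno := three_not_comp h.pc ha.ne' hae hxe (Or.inl m1 : Miss G ψ a g4 ∨ Miss G ψ a g2)
    (Or.inr m2) (Or.inl m4)
  by_cases hr : (HH G ψ g4 g2).Reachable a x
  · have hr' : ¬ (HH G ψ g4 g2).Reachable a e := fun h' => hno ⟨hr, h'⟩
    refine low_two (h.swap h1 h2 h1' h2' a) (lb.swap h1 h2 a) (le.swap h1 h2 a) hxe h1 h1' h3 h3' ?_ ?_ ?_
    · rw [miss_kswap_in hr, Equiv.swap_apply_left]; exact m2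
    · rw [miss_kswap_out hr']; exact m4
    · rw [miss_kswap_other n34 n23.symm]; exact m3
  · refine low_one (h.swap h1 h2 h1' h2' a) (la.swap h1 h2 a) h2 h2' ?_ ?_
    · rw [miss_kswap_out hr]; exact m2
    · rw [miss_kswap_in (SimpleGraph.Reachable.refl a), Equiv.swap_apply_right]; exact m1

open Classical in
lemma small_coloring (G : SimpleGraph V) (D : ℕ) (hD : D ≤ 4) (hdeg : ∀ v, G.degree v ≤ D) :
    ∃ ψ, PC G ψ ∧ (∀ a b, G.Adj a b → ψ s(a, b) < D + 1) ∧ ∀ x, ¬ Full G ψ 0 1 x := by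
  have hex : ∃ n, ∃ ψ, PC G ψ ∧ From G ψ (Finset.range (D + 1)) ∧ low G ψ = n := by
    obtain ⟨ψ, h1, h2⟩ := vizing G D hdeg
    exact ⟨_, ψ, h1, fun a b h => Finset.mem_range.mpr (h2 a b h), rfl⟩
  obtain ⟨ψ, h1, h2, h3⟩ := Nat.find_spec hex
  have hmin : LowMin G D ψ := ⟨h1, h2, fun φ hφ hφ' => by
    rw [h3]; exact Nat.find_min' hex ⟨φ, hφ, hφ', rfl⟩⟩
  exact ⟨ψ, h1, fun a b h => Finset.mem_range.mp (h2 a b h), fun x => low_full hmin hD hdeg x⟩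
end

open Finset

section
variable {V : Type*} [Fintype V]

open Classical in
/-- few two-colored cycles of each length through an edge -/
def Cnt (G : SimpleGraph V) (ψ : Sym2 V → ℕ) (k : ℕ) : Prop :=
  ∀ a b, G.Adj a b → ∀ t : ℕ,
    (#{d ∈ Finset.range k | d ≠ ψ s(a, b) ∧ Full G ψ (ψ s(a, b)) d a ∧
      #(Comp G ψ (ψ s(a, b)) d a) = 2 * t} : ℝ) ≤ 2 ^ 61 * 1.1 ^ t

open Classical in
lemma count_const {I : Type*} [Fintype I] (T : Finset I) (hT : T.Nonempty) :
    (#{f : I → Bool | ∀ e ∈ T, ∀ e' ∈ T, f e = f e'} : ℝ) ≤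
      (2 * (1 / 2) ^ #T) * Fintype.card (I → Bool) := by
  obtain ⟨e0, h0⟩ := hT
  have h1 : #{f : I → Bool | ∀ e ∈ T, ∀ e' ∈ T, f e = f e'} ≤
      #(Finset.univ : Finset (Bool × ({e // e ∈ (Finset.univ \ T)} → Bool))) := by
    apply Finset.card_le_card_of_injOn (fun f => (f e0, fun e => f e.1))
    · intro f _; simp
    · intro f hf g hg hfg
      simp only [coe_filter, mem_univ, true_and, Set.mem_ofPred_eq] at hf hg
      simp only [Prod.mk.injEq] at hfg
      ext e
      by_cases he : e ∈ T
      · rw [hf e he e0 h0, hg e he e0 h0, hfg.1]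
      · exact congrFun hfg.2 ⟨e, by simp [he]⟩
  rw [Finset.card_univ, Fintype.card_prod, Fintype.card_fun, Fintype.card_bool,
    Fintype.card_coe] at h1
  have h2 : Fintype.card I = #(Finset.univ \ T) + #T := by
    rw [Finset.card_sdiff_add_card_eq_card (Finset.subset_univ T), Finset.card_univ]
  rw [Fintype.card_fun, Fintype.card_bool, h2]
  calc _ ≤ ((2 * 2 ^ #(Finset.univ \ T) : ℕ) : ℝ) := by exact_mod_cast h1
    _ = _ := by
      push_cast
      rw [pow_add, one_div, inv_pow]
      field_simp

variable {G : SimpleGraph V} {ψ : Sym2 V → ℕ} {k : ℕ}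

open Classical in
lemma bits (hψ : PC G ψ) (hcnt : Cnt G ψ k) :
    ∃ f : Sym2 V → Bool, ∀ c d x, c < k → d < k → c ≠ d → Full G ψ c d x →
      219 ≤ #(Comp G ψ c d x) → ∃ e ∈ FE G ψ c (Comp G ψ c d x), ∃ e' ∈ FE G ψ c (Comp G ψ c d x),
        f e ≠ f e' := by
  let P : (Fin k × Fin k) × Finset V → Prop := fun p => p.1.1 ≠ p.1.2 ∧ 219 ≤ #p.2 ∧
    ∃ x, Full G ψ p.1.1 p.1.2 x ∧ p.2 = Comp G ψ p.1.1 p.1.2 x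
  let J := {p : (Fin k × Fin k) × Finset V // P p}
  let vbl : J → Finset (Sym2 V) := fun j => FE G ψ j.1.1.1 j.1.2
  have hcard : ∀ j : J, #j.1.2 = 2 * #(vbl j) := by
    intro j
    obtain ⟨h1, h2, x, hx, h3⟩ := j.2
    simp only [vbl]
    rw [h3]
    exact card_Comp hψ hx
  have hge : ∀ j : J, 110 ≤ #(vbl j) := by
    intro j
    have := hcard j
    have h2 := j.2.2.1
    omega
  have main := local_lemma (I := Sym2 V) (Q := Bool) (J := J) vbl
    (fun j f => ∀ e ∈ vbl j, ∀ e' ∈ vbl j, f e = f e')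
    (fun j => Finset.card_pos.mp (lt_of_lt_of_le (by norm_num) (hge j)))
    (fun j f g hfg hf e he e' he' => by rw [← hfg e he, ← hfg e' he']; exact hf e he e' he')
    (fun j => 2 * (1 / 2) ^ #(vbl j))
    (fun j => by
      have := count_const (vbl j) (Finset.card_pos.mp (lt_of_lt_of_le (by norm_num) (hge j)))
      convert this) (9 / 10) (by norm_num) ?_
  · obtain ⟨f, hf⟩ := main
    refine ⟨f, fun c d x hc hd hcd hF hs => ?_⟩
    have := hf ⟨((⟨c, hc⟩, ⟨d, hd⟩), Comp G ψ c d x), ⟨by simpa using hcd, hs, x, hF, rfl⟩⟩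
    push Not at this
    exact this
  · intro i
    have hw : ∀ j : J, (2 * (1 / 2 : ℝ) ^ #(vbl j)) * ((9 / 10 : ℝ)⁻¹) ^ (#(vbl j) - 1) =
        (5 / 9) ^ (#(vbl j) - 1) := by
      intro j
      obtain ⟨n, hn⟩ : ∃ n, #(vbl j) = n + 1 := ⟨#(vbl j) - 1, by have := hge j; omega⟩
      rw [hn, Nat.add_sub_cancel, pow_succ, show (5 / 9 : ℝ) = (1 / 2) * (9 / 10)⁻¹ by norm_num,
        mul_pow]
      ring
    simp_rw [hw]
    set T := Fintype.card (Sym2 V) + 1 with hT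
    rw [← Finset.sum_fiberwise_of_maps_to (t := Finset.Ico 110 T) (g := fun j => #(vbl j))
      (fun j _ => by
        rw [Finset.mem_Ico]
        exact ⟨hge j, Nat.lt_succ_of_le (Finset.card_le_univ _)⟩)]
    have hcnt' : ∀ t, (#{j : J | i ∈ vbl j ∧ #(vbl j) = t} : ℝ) ≤ 2 ^ 61 * 1.1 ^ t := by
      intro t
      induction i with
      | _ a b =>
      by_cases hab : G.Adj a b
      · refine le_trans ?_ (hcnt a b hab t)
        norm_cast
        have hmem : ∀ j : J, s(a, b) ∈ vbl j → (j.1.1.1 : ℕ) = ψ s(a, b) ∧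
            Full G ψ (ψ s(a, b)) j.1.1.2 a ∧ j.1.2 = Comp G ψ (ψ s(a, b)) j.1.1.2 a := by
          rintro ⟨⟨⟨c, d⟩, S⟩, h1, h2, x, hx, h3⟩ hj
          simp only at h3 hx
          simp only [vbl] at hj
          obtain ⟨he, hc, y, hy, hye⟩ := mem_FE.mp hj
          have hr : (HH G ψ c d).Reachable x a := by
            rw [h3] at hy
            have hxy := mem_Comp.mp hy
            rcases Sym2.mem_iff.mp hye with rfl | rfl
            · exact hxy
            · refine hxy.trans (SimpleGraph.Adj.reachable ⟨hab.symm, Or.inl ?_⟩)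
              rw [Sym2.eq_swap]; exact hc
          refine ⟨hc.symm, ?_, ?_⟩
          · rw [hc]
            exact fun y hy => hx y (hr.trans hy)
          · rw [hc, Comp_eq hr]
            exact h3
        apply Finset.card_le_card_of_injOn (fun j => (j.1.1.2 : ℕ))
        · intro j hj
          simp only [coe_filter, mem_univ, true_and, Set.mem_ofPred_eq] at hj
          obtain ⟨m1, m2, m3⟩ := hmem j hj.1
          simp only [coe_filter, Set.mem_ofPred_eq, Finset.mem_range]
          refine ⟨j.1.1.2.2, ?_, m2, ?_⟩
          · rw [← m1]
            exact fun h => j.2.1 (Fin.ext h.symm)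
          · rw [← m3, hcard j, hj.2]
        · intro j hj j' hj' hjj
          simp only [coe_filter, mem_univ, true_and, Set.mem_ofPred_eq] at hj hj'
          obtain ⟨m1, m2, m3⟩ := hmem j hj.1
          obtain ⟨m1', m2', m3'⟩ := hmem j' hj'.1
          simp only at hjj
          apply Subtype.ext
          refine Prod.ext (Prod.ext (Fin.ext (m1.trans m1'.symm)) (Fin.ext hjj)) ?_
          rw [m3, m3', hjj]
      · have : (#{j : J | s(a, b) ∈ vbl j ∧ #(vbl j) = t}) = 0 := by
          rw [Finset.card_eq_zero, Finset.filter_eq_empty_iff]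
          rintro j - ⟨hj, -⟩
          exact hab (mem_FE.mp hj).1
        rw [this]
        simp only [Nat.cast_zero]
        positivity
    calc _ ≤ ∑ t ∈ Finset.Ico 110 T, (2 ^ 61 * (9 / 5)) * (11 / 18 : ℝ) ^ t := by
          apply Finset.sum_le_sum
          intro t ht
          rw [Finset.mem_Ico] at ht
          rw [Finset.filter_filter]
          refine le_trans (le_of_eq (Finset.sum_congr rfl (g := fun _ => (5 / 9 : ℝ) ^ (t - 1)) ?_)) ?_
          · intro j hj
            have hj' := ((@Finset.mem_filter _ _ (_) _ _).mp hj).2.2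
            rw [hj']
          rw [Finset.sum_const, nsmul_eq_mul]
          calc _ ≤ 2 ^ 61 * 1.1 ^ t * (5 / 9 : ℝ) ^ (t - 1) :=
                mul_le_mul_of_nonneg_right (by convert hcnt' t <;> rfl) (by positivity)
            _ = _ := by
              obtain ⟨n, rfl⟩ : ∃ n, t = n + 1 := ⟨t - 1, by omega⟩
              rw [Nat.add_sub_cancel, show (11 / 18 : ℝ) = 1.1 * (5 / 9) by norm_num, mul_pow,
                pow_succ (5 / 9 : ℝ)]
              ring
      _ ≤ (2 ^ 61 * (9 / 5)) * ((11 / 18 : ℝ) ^ 110 / (1 - 11 / 18)) := by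
          rw [← Finset.mul_sum]
          apply mul_le_mul_of_nonneg_left _ (by norm_num)
          exact geom_sum_Ico_le_of_lt_one (by norm_num) (by norm_num)
      _ ≤ 1 - 9 / 10 := by norm_num
end

open Finset

section
variable {V : Type*} [Fintype V]

lemma assemble {G : SimpleGraph V} {ψ : Sym2 V → ℕ} {k z : ℕ} (hψ : PC G ψ)
    (hk : ∀ a b, G.Adj a b → ψ s(a, b) < k) (hcnt : Cnt G ψ k) (hz : z ≤ k)
    (hZ : ∀ c d x, c < z → d < z → c ≠ d → ¬ Full G ψ c d x)
    (hgirth : ∀ (v : V) (w : G.Walk v v), w.IsCycle → 219 ≤ w.length) :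
    ∃ col : Sym2 V → ℕ,
      (∀ e ∈ G.edgeSet, col e < 2 * k - z) ∧
      IsProperEdgeColoring G col ∧
      ∀ (v : V) (w : G.Walk v v), w.IsCycle →
        3 ≤ (w.edges.map col).toFinset.card := by
  obtain ⟨f, hf⟩ := bits hψ hcnt
  have hk' : ∀ e ∈ G.edgeSet, ψ e < k := by
    intro e he
    induction e with
    | _ a b => exact hk a b he
  set col : Sym2 V → ℕ := fun e => if ψ e < z ∨ f e = true then ψ e else ψ e + (k - z) with hcol
  have inj : ∀ e ∈ G.edgeSet, ∀ e' ∈ G.edgeSet, col e = col e' → ψ e = ψ e' := by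
    intro e he e' he' h
    have := hk' e he
    have := hk' e' he'
    simp only [hcol] at h
    split_ifs at h <;> omega
  have inj2 : ∀ e e', z ≤ ψ e → ψ e = ψ e' → ψ e < k → f e ≠ f e' → col e ≠ col e' := by
    intro e e' hze hee hek hff h
    simp only [hcol, ← hee] at h
    cases h1 : f e <;> cases h2 : f e' <;> simp_all <;> omega
  refine ⟨col, ?_, ?_, ?_⟩
  · intro e he
    have := hk' e he
    simp only [hcol]
    split_ifs <;> omega
  · rintro e1 he1 e2 he2 hne ⟨v, ⟨a, rfl⟩, ⟨b, rfl⟩⟩ h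
    exact hψ v a b he1 he2 (fun h => hne (by rw [h])) (inj _ he1 _ he2 h)
  · intro v w hw
    have hlen := hgirth v w hw
    -- the main case
    have main : ∀ c d, (∀ e ∈ w.edges, ψ e = c ∨ ψ e = d) → z ≤ c →
        3 ≤ (w.edges.map col).toFinset.card := by
      intro c d hcd hzc
      obtain ⟨hne, hF, hcard, hcl⟩ := cycle_full hψ hw hcd
      obtain ⟨⟨u1, hu1, hu1'⟩, ⟨u2, hu2, hu2'⟩⟩ := hF v (SimpleGraph.Reachable.refl v)
      have hvm : v ∈ Comp G ψ c d v := mem_Comp.mpr (SimpleGraph.Reachable.refl v)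
      have hck : c < k := hu1' ▸ hk v u1 hu1
      have hdk : d < k := hu2' ▸ hk v u2 hu2
      obtain ⟨e, he, e', he', hee⟩ := hf c d v hck hdk hne hF (by omega)
      have hin : ∀ e ∈ FE G ψ c (Comp G ψ c d v), e ∈ w.edges ∧ ψ e = c := by
        intro e he
        obtain ⟨h1, h2, y, hy, x, rfl⟩ := mem_FE.mp he
        exact ⟨hcl y hy x h1 (Or.inl h2), h2⟩
      obtain ⟨i1, i1'⟩ := hin e he
      obtain ⟨i2, i2'⟩ := hin e' he'
      have i3 : s(v, u2) ∈ w.edges := hcl v hvm u2 hu2 (Or.inr hu2')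
      have hE : ∀ e ∈ w.edges, e ∈ G.edgeSet := fun e he => w.edges_subset_edgeSet he
      have n1 : col e ≠ col e' := inj2 e e' (by omega) (by omega) (by omega) hee
      have n2 : col e ≠ col s(v, u2) := fun h => by
        have := inj _ (hE _ i1) _ (hE _ i3) h
        omega
      have n3 : col e' ≠ col s(v, u2) := fun h => by
        have := inj _ (hE _ i2) _ (hE _ i3) h
        omega
      have : #({col e, col e', col s(v, u2)} : Finset ℕ) = 3 := by
        rw [Finset.card_eq_three]
        exact ⟨_, _, _, n1, n2, n3, rfl⟩
      rw [← this]
      apply Finset.card_le_card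
      intro x hx
      simp only [Finset.mem_insert, Finset.mem_singleton] at hx
      rw [List.mem_toFinset, List.mem_map]
      rcases hx with rfl | rfl | rfl
      · exact ⟨_, i1, rfl⟩
      · exact ⟨_, i2, rfl⟩
      · exact ⟨_, i3, rfl⟩
    by_contra hlt
    set dec : ℕ → ℕ := fun n => if n < k then n else n - (k - z) with hdec
    have hdc : ∀ e ∈ w.edges, dec (col e) = ψ e := by
      intro e he
      have := hk' e (w.edges_subset_edgeSet he)
      simp only [hdec, hcol]
      split_ifs <;> omega
    have hsub : (w.edges.map ψ).toFinset ⊆ (w.edges.map col).toFinset.image dec := by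
      intro x hx
      rw [List.mem_toFinset, List.mem_map] at hx
      obtain ⟨e, he, rfl⟩ := hx
      rw [Finset.mem_image]
      exact ⟨col e, by rw [List.mem_toFinset, List.mem_map]; exact ⟨e, he, rfl⟩, hdc e he⟩
    have hc2 : #((w.edges.map ψ).toFinset) ≤ 2 := by
      have := (Finset.card_le_card hsub).trans Finset.card_image_le
      omega
    obtain ⟨c, d, hcd⟩ : ∃ c d, ∀ e ∈ w.edges, ψ e = c ∨ ψ e = d := by
      have hmem : ∀ e ∈ w.edges, ψ e ∈ (w.edges.map ψ).toFinset := by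
        intro e he
        rw [List.mem_toFinset, List.mem_map]; exact ⟨e, he, rfl⟩
      generalize (w.edges.map ψ).toFinset = S at hc2 hmem
      have h3 : #S = 0 ∨ #S = 1 ∨ #S = 2 := by omega
      rcases h3 with h | h | h
      · rw [Finset.card_eq_zero] at h
        subst h
        exact ⟨0, 0, fun e he => by simpa using hmem e he⟩
      · obtain ⟨a, rfl⟩ := Finset.card_eq_one.mp h
        exact ⟨a, a, fun e he => by simpa using hmem e he⟩
      · obtain ⟨a, b, -, rfl⟩ := Finset.card_eq_two.mp h
        exact ⟨a, b, fun e he => by simpa using hmem e he⟩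
    by_cases h1 : z ≤ c
    · exact hlt (main c d hcd h1)
    by_cases h2 : z ≤ d
    · exact hlt (main d c (fun e he => (hcd e he).symm) h2)
    obtain ⟨hne, hF, -, -⟩ := cycle_full hψ hw hcd
    exact hZ c d v (by omega) (by omega) hne hF
end

open Finset

open Classical in
lemma tail_count {I Q : Type*} [Fintype I] [Fintype Q] [Nonempty Q] (N : Finset I) (q : Q)
    (n : ℕ) (x : ℝ) (hx : 1 ≤ x) :
    (#{f : I → Q | n < #{u ∈ N | f u = q}} : ℝ) ≤
      ((1 + (x - 1) / Fintype.card Q) ^ #N / x ^ (n + 1)) * Fintype.card (I → Q) := by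
  have hx0 : 0 < x := by linarith
  have hs : (0 : ℝ) < Fintype.card Q := by exact_mod_cast Fintype.card_pos
  have h1 : ∑ f : I → Q, x ^ #{u ∈ N | f u = q} =
      (1 + (x - 1) / Fintype.card Q) ^ #N * Fintype.card (I → Q) := by
    have e1 : ∀ f : I → Q, x ^ #{u ∈ N | f u = q} = ∏ u, (if u ∈ N ∧ f u = q then x else 1) := by
      intro f
      rw [Finset.prod_ite, Finset.prod_const, Finset.prod_const_one, mul_one]
      congr 2
      ext u; simp
    have e2 : ∀ u : I, ∑ q' : Q, (if u ∈ N ∧ q' = q then x else 1) =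
        Fintype.card Q * (if u ∈ N then (1 + (x - 1) / Fintype.card Q) else 1) := by
      intro u
      by_cases hu : u ∈ N
      · have : ∀ q' : Q, (if u ∈ N ∧ q' = q then x else 1) = 1 + (if q' = q then (x - 1) else 0) := by
          intro q'
          by_cases h : q' = q <;> simp [hu, h]
        simp_rw [this]
        rw [Finset.sum_add_distrib, Finset.sum_ite_eq']
        simp only [sum_const, card_univ, nsmul_eq_mul, mul_one, mem_univ, if_true, hu]
        field_simp
      · simp [hu]
    simp_rw [e1]
    have := Finset.prod_univ_sum (fun _ : I => (Finset.univ : Finset Q))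
      (fun (u : I) (q' : Q) => (if u ∈ N ∧ q' = q then x else 1))
    rw [Fintype.piFinset_univ] at this
    rw [← this]
    simp_rw [e2]
    rw [Finset.prod_mul_distrib, Finset.prod_ite, Finset.prod_const, Finset.prod_const,
      Finset.prod_const_one, mul_one, Fintype.card_fun]
    have hN : #({u ∈ (Finset.univ : Finset I) | u ∈ N}) = #N := by congr 1; ext; simp
    rw [hN, Finset.card_univ]
    push_cast
    ring
  have h2 : (#{f : I → Q | n < #{u ∈ N | f u = q}} : ℝ) * x ^ (n + 1) ≤
      ∑ f : I → Q, x ^ #{u ∈ N | f u = q} := by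
    rw [← nsmul_eq_mul, ← Finset.sum_const]
    calc _ ≤ ∑ f : I → Q with n < #{u ∈ N | f u = q}, x ^ #{u ∈ N | f u = q} := by
          apply Finset.sum_le_sum
          intro f hf
          rw [Finset.mem_filter] at hf
          exact pow_le_pow_right₀ hx hf.2
      _ ≤ _ := by
          apply Finset.sum_le_sum_of_subset_of_nonneg (Finset.filter_subset _ _)
          intro f _ _
          positivity
  rw [h1] at h2
  rw [div_mul_eq_mul_div, le_div_iff₀ (by positivity)]
  exact h2

open Classical in
lemma labels {V Q : Type*} [Fintype V] [Fintype Q] [Nonempty Q] (G : SimpleGraph V) (D n : ℕ)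
    (hD : 1 ≤ D) (hdeg : ∀ v, G.degree v ≤ D) (x : ℝ) (hx : 1 ≤ x)
    (hnum : (Fintype.card Q : ℝ) * ((1 + (x - 1) / Fintype.card Q) ^ D / x ^ (n + 1)) ≤
      1 / (4 * D * (D + 1))) :
    ∃ f : V → Q, ∀ v q, #{u ∈ G.neighborFinset v | f u = q} ≤ n := by
  have hs : (0 : ℝ) < Fintype.card Q := by exact_mod_cast Fintype.card_pos
  have hD' : (1 : ℝ) ≤ D := by exact_mod_cast hD
  have hbase : 1 ≤ 1 + (x - 1) / Fintype.card Q := by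
    have : 0 ≤ (x - 1) / Fintype.card Q := div_nonneg (by linarith) hs.le
    linarith
  let J := {v : V // (G.neighborFinset v).Nonempty}
  have main := local_lemma (I := V) (Q := Q) (J := J) (fun j => G.neighborFinset j.1)
    (fun j f => ∃ q, n < #{u ∈ G.neighborFinset j.1 | f u = q}) (fun j => j.2)
    (fun j f g hfg => by
      rintro ⟨q, hq⟩
      refine ⟨q, lt_of_lt_of_eq hq ?_⟩
      congr 1
      apply Finset.filter_congr
      intro u hu
      rw [hfg u hu])
    (fun _ => 1 / (4 * D * (D + 1))) ?_ (D / (D + 1)) (by positivity) ?_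
  · obtain ⟨f, hf⟩ := main
    refine ⟨f, fun v q => ?_⟩
    by_cases hv : (G.neighborFinset v).Nonempty
    · have := hf ⟨v, hv⟩
      push Not at this
      exact this q
    · rw [Finset.not_nonempty_iff_eq_empty] at hv
      rw [hv]; simp
  · intro j
    have h1 : (#{f : V → Q | ∃ q, n < #{u ∈ G.neighborFinset j.1 | f u = q}} : ℝ) ≤
        ∑ q : Q, (#{f : V → Q | n < #{u ∈ G.neighborFinset j.1 | f u = q}} : ℝ) := by
      have : ({f : V → Q | ∃ q, n < #{u ∈ G.neighborFinset j.1 | f u = q}} : Finset (V → Q)) ⊆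
          Finset.univ.biUnion (fun q => {f : V → Q | n < #{u ∈ G.neighborFinset j.1 | f u = q}}) := by
        intro f
        simp
      exact_mod_cast (Finset.card_le_card this).trans Finset.card_biUnion_le
    refine le_trans (le_of_eq (by congr!)) (h1.trans ?_)
    have h2 : ∀ q : Q, (#{f : V → Q | n < #{u ∈ G.neighborFinset j.1 | f u = q}} : ℝ) ≤
        ((1 + (x - 1) / Fintype.card Q) ^ D / x ^ (n + 1)) * Fintype.card (V → Q) := by
      intro q
      refine (tail_count (G.neighborFinset j.1) q n x hx).trans ?_
      have hc : #(G.neighborFinset j.1) ≤ D := by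
        rw [SimpleGraph.card_neighborFinset_eq_degree]; exact hdeg j.1
      gcongr
    refine (Finset.sum_le_sum (fun q _ => h2 q)).trans ?_
    rw [Finset.sum_const, nsmul_eq_mul, ← mul_assoc, Finset.card_univ]
    have h3 := mul_le_mul_of_nonneg_right hnum (Nat.cast_nonneg (α := ℝ) (Fintype.card (V → Q)))
    convert h3 using 2
  · intro i
    have hcard : #{j : J | i ∈ G.neighborFinset j.1} ≤ D := by
      refine le_trans ?_ (hdeg i)
      rw [← SimpleGraph.card_neighborFinset_eq_degree]
      apply Finset.card_le_card_of_injOn (fun j => j.1)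
      · intro j hj
        simp only [coe_filter, mem_univ, true_and, Set.mem_ofPred_eq,
          SimpleGraph.mem_neighborFinset] at hj
        simpa using hj.symm
      · intro a _ b _ h
        exact Subtype.ext h
    have hexp : ((D / (D + 1) : ℝ)⁻¹) ^ D ≤ 4 := by
      have h1 : (D / (D + 1) : ℝ)⁻¹ = 1 / D + 1 := by field_simp; ring
      rw [h1]
      calc _ ≤ (Real.exp (1 / D)) ^ D := by
            gcongr
            exact Real.add_one_le_exp _
        _ = Real.exp 1 := by
            rw [← Real.exp_nat_mul]
            congr 1
            field_simp
        _ ≤ 4 := by linarith [Real.exp_one_lt_d9]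
    have hone : 1 ≤ (D / (D + 1) : ℝ)⁻¹ := by
      rw [inv_div, le_div_iff₀ (by positivity)]; linarith
    have hterm : ∀ j : J, 1 / (4 * D * (D + 1) : ℝ) * ((D / (D + 1) : ℝ)⁻¹) ^
        (#(G.neighborFinset j.1) - 1) ≤ 1 / (D * (D + 1)) := by
      intro j
      have hc : #(G.neighborFinset j.1) - 1 ≤ D := by
        rw [SimpleGraph.card_neighborFinset_eq_degree]
        exact (Nat.sub_le _ _).trans (hdeg j.1)
      calc _ ≤ 1 / (4 * D * (D + 1) : ℝ) * 4 := by
            gcongr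
            exact (pow_le_pow_right₀ hone hc).trans hexp
        _ = _ := by field_simp
    refine (Finset.sum_le_sum (fun j _ => hterm j)).trans ?_
    rw [Finset.sum_const, nsmul_eq_mul]
    calc _ ≤ (D : ℝ) * (1 / (D * (D + 1))) := by
          gcongr
      _ = 1 - D / (D + 1) := by field_simp; ring

open Finset

section
variable {V : Type*} [Fintype V]

/-- edges whose endpoint labels sum to `i` -/
def Hs {s : ℕ} (G : SimpleGraph V) (f : V → ZMod s) (i : ZMod s) : SimpleGraph V where
  Adj u v := G.Adj u v ∧ f u + f v = i
  symm := ⟨fun u v h => ⟨h.1.symm, by rw [add_comm]; exact h.2⟩⟩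
  loopless := ⟨fun u h => h.1.ne rfl⟩

/-- label sum of an edge -/
def lab {s : ℕ} (f : V → ZMod s) : Sym2 V → ZMod s :=
  Sym2.lift ⟨fun a b => f a + f b, fun a b => add_comm _ _⟩

/-- combined coloring -/
def comb {s : ℕ} (f : V → ZMod s) (k' : ℕ) (φ : ZMod s → Sym2 V → ℕ) : Sym2 V → ℕ :=
  fun e => (lab f e).val * k' + φ (lab f e) e

lemma decode {s : ℕ} [NeZero s] {k' c c' : ℕ} {i j : ZMod s} (hc : c < k') (hc' : c' < k')
    (h : i.val * k' + c = j.val * k' + c') : i = j ∧ c = c' := by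
  have h1 : (i.val * k' + c) / k' = i.val := by
    rw [Nat.mul_comm, Nat.mul_add_div (by omega), Nat.div_eq_of_lt hc, Nat.add_zero]
  have h2 : (j.val * k' + c') / k' = j.val := by
    rw [Nat.mul_comm, Nat.mul_add_div (by omega), Nat.div_eq_of_lt hc', Nat.add_zero]
  have h3 : i.val = j.val := by rw [← h1, ← h2, h]
  refine ⟨ZMod.val_injective s h3, ?_⟩
  rw [h3] at h
  omega

lemma comb_iff {s : ℕ} [NeZero s] {G : SimpleGraph V} {f : V → ZMod s} {k' : ℕ}
    {φ : ZMod s → Sym2 V → ℕ} (h2 : ∀ i a b, (Hs G f i).Adj a b → φ i s(a, b) < k')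
    {a b : V} (hab : G.Adj a b) {i : ZMod s} {c : ℕ} (hc : c < k') :
    comb f k' φ s(a, b) = i.val * k' + c ↔ f a + f b = i ∧ φ i s(a, b) = c := by
  have hl : lab f s(a, b) = f a + f b := rfl
  unfold comb
  rw [hl]
  constructor
  · intro h
    obtain ⟨e1, e2⟩ := decode (h2 _ a b ⟨hab, rfl⟩) hc h
    exact ⟨e1, by rw [← e1]; exact e2⟩
  · rintro ⟨rfl, rfl⟩
    rfl

lemma sq_bound (t : ℕ) : (8 * t ^ 2 : ℝ) ≤ 2 ^ 61 * 1.1 ^ t := by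
  have h1 : (1 + t * 0.04 : ℝ) ≤ (1 + 0.04) ^ t := one_add_mul_le_pow (by norm_num) t
  have h2 : ((1 + 0.04 : ℝ) ^ t) ^ 2 ≤ 1.1 ^ t := by
    rw [← pow_mul, mul_comm, pow_mul]
    gcongr
    norm_num
  have h3 : (1 + t * 0.04 : ℝ) ^ 2 ≤ 1.1 ^ t := by
    refine le_trans ?_ h2
    gcongr
  have ht : (0 : ℝ) ≤ t := Nat.cast_nonneg t
  nlinarith

lemma cross {s : ℕ} [hs : Fact s.Prime] {G : SimpleGraph V} {f : V → ZMod s} {ψ : Sym2 V → ℕ}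
    {c d : ℕ} {i j : ZMod s} (hij : i ≠ j)
    (hc : ∀ a b, G.Adj a b → ψ s(a, b) = c → f a + f b = i)
    (hd : ∀ a b, G.Adj a b → ψ s(a, b) = d → f a + f b = j) {x : V} (hF : Full G ψ c d x) :
    s ≤ #(Comp G ψ c d x) := by
  classical
  have hstep : ∀ y, (HH G ψ c d).Reachable x y →
      ∃ z, (HH G ψ c d).Reachable x z ∧ f z = f y + (j - i) := by
    intro y hy
    obtain ⟨⟨u, hu, huc⟩, -⟩ := hF y hy
    have hxu : (HH G ψ c d).Reachable x u := hy.trans (SimpleGraph.Adj.reachable ⟨hu, Or.inl huc⟩)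
    obtain ⟨-, ⟨w, hw, hwd⟩⟩ := hF u hxu
    refine ⟨w, hxu.trans (SimpleGraph.Adj.reachable ⟨hw, Or.inr hwd⟩), ?_⟩
    have e1 := hc y u hu huc
    have e2 := hd u w hw hwd
    rw [← e1, ← e2]; ring
  have hiter : ∀ n : ℕ, ∃ z, (HH G ψ c d).Reachable x z ∧ f z = f x + n * (j - i) := by
    intro n
    induction n with
    | zero => exact ⟨x, SimpleGraph.Reachable.refl _, by simp⟩
    | succ n ih =>
      obtain ⟨y, hy, hfy⟩ := ih
      obtain ⟨z, hz, hfz⟩ := hstep y hy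
      refine ⟨z, hz, ?_⟩
      rw [hfz, hfy]; push_cast; ring
  have hsurj : (Finset.univ : Finset (ZMod s)) ⊆ (Comp G ψ c d x).image f := by
    intro q _
    obtain ⟨z, hz, hfz⟩ := hiter ((q - f x) / (j - i)).val
    rw [Finset.mem_image]
    refine ⟨z, mem_Comp.mpr hz, ?_⟩
    rw [hfz, ZMod.natCast_zmod_val, div_mul_cancel₀ _ (sub_ne_zero.mpr hij.symm)]
    ring
  have := (Finset.card_le_card hsurj).trans Finset.card_image_le
  rwa [Finset.card_univ, ZMod.card] at this

open Classical in
lemma combine {s : ℕ} [hs : Fact s.Prime] (G : SimpleGraph V) (f : V → ZMod s) (k' : ℕ)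
    (φ : ZMod s → Sym2 V → ℕ) (h1 : ∀ i, PC (Hs G f i) (φ i))
    (h2 : ∀ i a b, (Hs G f i).Adj a b → φ i s(a, b) < k')
    (h3 : ∀ i, Cnt (Hs G f i) (φ i) k') (hk : k' ≤ 2 * s) :
    PC G (comb f k' φ) ∧ (∀ a b, G.Adj a b → comb f k' φ s(a, b) < s * k') ∧
      Cnt G (comb f k' φ) (s * k') := by
  have hlt : ∀ a b, G.Adj a b → comb f k' φ s(a, b) < s * k' := by
    intro a b hab
    have hl : lab f s(a, b) = f a + f b := rfl
    have hc := h2 _ a b ⟨hab, rfl⟩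
    have hv := ZMod.val_lt (f a + f b)
    unfold comb
    rw [hl]
    calc _ < (f a + f b).val * k' + k' := by omega
      _ = ((f a + f b).val + 1) * k' := by ring
      _ ≤ s * k' := Nat.mul_le_mul_right _ hv
  refine ⟨?_, hlt, ?_⟩
  · intro v u w hu hw huw he
    have e := (comb_iff h2 hu (i := f v + f w) (h2 (f v + f w) v w ⟨hw, rfl⟩)).mp he
    exact h1 (f v + f w) v u w ⟨hu, e.1⟩ ⟨hw, rfl⟩ huw e.2
  · intro a b hab t
    set i := f a + f b with hi
    set c' := φ i s(a, b) with hc'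
    have hc'k : c' < k' := h2 i a b ⟨hab, rfl⟩
    have hcol : comb f k' φ s(a, b) = i.val * k' + c' := (comb_iff h2 hab hc'k).mpr ⟨rfl, rfl⟩
    rw [hcol]
    by_cases hts : s ≤ 2 * t
    · refine le_trans ?_ (sq_bound t)
      have e1 : #{d ∈ Finset.range (s * k') | d ≠ i.val * k' + c' ∧
          Full G (comb f k' φ) (i.val * k' + c') d a ∧
          #(Comp G (comb f k' φ) (i.val * k' + c') d a) = 2 * t} ≤ s * k' :=
        (Finset.card_filter_le _ _).trans (by simp)
      have e2 : s * k' ≤ 8 * t ^ 2 := by nlinarith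
      exact_mod_cast e1.trans e2
    · refine le_trans ?_ (h3 i a b ⟨hab, rfl⟩ t)
      rw [← hc']
      have key : #{d ∈ Finset.range (s * k') | d ≠ i.val * k' + c' ∧
          Full G (comb f k' φ) (i.val * k' + c') d a ∧
          #(Comp G (comb f k' φ) (i.val * k' + c') d a) = 2 * t} ≤
          #{d ∈ Finset.range k' | d ≠ c' ∧ Full (Hs G f i) (φ i) c' d a ∧
            #(Comp (Hs G f i) (φ i) c' d a) = 2 * t} := by
        have hform : ∀ d ∈ ({d ∈ Finset.range (s * k') | d ≠ i.val * k' + c' ∧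
          Full G (comb f k' φ) (i.val * k' + c') d a ∧
          #(Comp G (comb f k' φ) (i.val * k' + c') d a) = 2 * t} : Finset ℕ),
            d = i.val * k' + d % k' := by
          intro d hd
          simp only [mem_filter, Finset.mem_range] at hd
          obtain ⟨hds, -, hF, hC⟩ := hd
          have hk0 : 0 < k' := by omega
          have hdk : d / k' < s := Nat.div_lt_of_lt_mul (by rw [mul_comm]; exact hds)
          have hval : ((d / k' : ℕ) : ZMod s).val = d / k' := ZMod.val_cast_of_lt hdk
          have hdd : d = ((d / k' : ℕ) : ZMod s).val * k' + d % k' := by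
            rw [hval, mul_comm]; exact (Nat.div_add_mod d k').symm
          by_cases hij : i = ((d / k' : ℕ) : ZMod s)
          · rw [hij]; exact hdd
          · exfalso
            have := cross (f := f) hij (fun x y hxy h => ((comb_iff h2 hxy hc'k).mp h).1)
              (fun x y hxy h => ((comb_iff h2 hxy (Nat.mod_lt d hk0)).mp (h.trans hdd)).1) hF
            omega
        apply Finset.card_le_card_of_injOn (fun d => d % k')
        · intro d hd
          have hdf := hform d hd
          simp only [coe_filter, Finset.mem_range, Set.mem_ofPred_eq] at hd ⊢
          obtain ⟨-, hne, hF, hC⟩ := hd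
          have hmod : d % k' < k' := Nat.mod_lt _ (by omega)
          generalize d % k' = d' at *
          subst hdf
          have hHH : HH G (comb f k' φ) (i.val * k' + c') (i.val * k' + d') =
              HH (Hs G f i) (φ i) c' d' := by
            ext x y
            simp only [HH, Hs]
            constructor
            · rintro ⟨hxy, h⟩
              rw [comb_iff h2 hxy hc'k, comb_iff h2 hxy hmod] at h
              rcases h with h | h
              · exact ⟨⟨hxy, h.1⟩, Or.inl h.2⟩
              · exact ⟨⟨hxy, h.1⟩, Or.inr h.2⟩
            · rintro ⟨⟨hxy, hs⟩, h⟩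
              refine ⟨hxy, ?_⟩
              rw [comb_iff h2 hxy hc'k, comb_iff h2 hxy hmod]
              exact h.imp (fun h => ⟨hs, h⟩) (fun h => ⟨hs, h⟩)
          refine ⟨hmod, fun h => hne (by rw [h]), ?_, ?_⟩
          · intro y hy
            rw [← hHH] at hy
            obtain ⟨⟨u, hu, hu'⟩, ⟨w, hw, hw'⟩⟩ := hF y hy
            rw [comb_iff h2 hu hc'k] at hu'
            rw [comb_iff h2 hw hmod] at hw'
            exact ⟨⟨u, ⟨hu, hu'.1⟩, hu'.2⟩, ⟨w, ⟨hw, hw'.1⟩, hw'.2⟩⟩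
          · rw [← hC]
            congr 1
            ext y
            rw [mem_Comp, mem_Comp, hHH]
        · intro d hd e he hde
          rw [hform d hd, hform e he]
          simp only at hde
          rw [hde]
      exact_mod_cast key

open Classical in
/-- enlarging the palette bound keeps the count -/
lemma Cnt.mono {G : SimpleGraph V} {ψ : Sym2 V → ℕ} {k l : ℕ} (h : Cnt G ψ k)
    (hk : ∀ a b, G.Adj a b → ψ s(a, b) < k) : Cnt G ψ l := by
  intro a b hab t
  refine le_trans ?_ (h a b hab t)
  have : ({d ∈ Finset.range l | d ≠ ψ s(a, b) ∧ Full G ψ (ψ s(a, b)) d a ∧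
      #(Comp G ψ (ψ s(a, b)) d a) = 2 * t} : Finset ℕ) ⊆
      {d ∈ Finset.range k | d ≠ ψ s(a, b) ∧ Full G ψ (ψ s(a, b)) d a ∧
      #(Comp G ψ (ψ s(a, b)) d a) = 2 * t} := by
    intro d hd
    simp only [mem_filter, Finset.mem_range] at hd ⊢
    refine ⟨?_, hd.2⟩
    obtain ⟨-, ⟨u, hu, hu'⟩⟩ := hd.2.2.1 a (SimpleGraph.Reachable.refl _)
    rw [← hu']
    exact hk a u hu
  exact_mod_cast Finset.card_le_card this

open Classical in
lemma Cnt.small {G : SimpleGraph V} {ψ : Sym2 V → ℕ} {k : ℕ} (h : k ≤ 2 ^ 61) : Cnt G ψ k := by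
  intro a b hab t
  have e1 : #{d ∈ Finset.range k | d ≠ ψ s(a, b) ∧ Full G ψ (ψ s(a, b)) d a ∧
      #(Comp G ψ (ψ s(a, b)) d a) = 2 * t} ≤ 2 ^ 61 :=
    (Finset.card_filter_le _ _).trans (by simpa using h)
  have e2 : (#{d ∈ Finset.range k | d ≠ ψ s(a, b) ∧ Full G ψ (ψ s(a, b)) d a ∧
      #(Comp G ψ (ψ s(a, b)) d a) = 2 * t} : ℝ) ≤ 2 ^ 61 := by exact_mod_cast e1
  have e3 : (1 : ℝ) ≤ 1.1 ^ t := one_le_pow₀ (by norm_num)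
  linarith

end

open Finset

lemma log_lower {D : ℕ} {m : ℕ} (hD : 2 ^ m ≤ D) : (m : ℝ) * 0.693 ≤ Real.log D := by
  have h1 : Real.log ((2 : ℝ) ^ m) ≤ Real.log D :=
    Real.log_le_log (by positivity) (by exact_mod_cast hD)
  rw [Real.log_pow] at h1
  have h2 : (0.693 : ℝ) ≤ Real.log 2 := by linarith [Real.log_two_gt_d9]
  have h3 : (m : ℝ) * 0.693 ≤ m * Real.log 2 := by gcongr
  linarith

set_option maxHeartbeats 2000000 in
lemma params (D : ℕ) (hD : 2 ^ 60 < D) : ∃ s n : ℕ, ∃ x : ℝ, s.Prime ∧ 1 ≤ x ∧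
    (s : ℝ) * ((1 + (x - 1) / s) ^ D / x ^ (n + 1)) ≤ 1 / (4 * D * (D + 1)) ∧
    2 ^ 28 ≤ n ∧ n < D ∧ (1.15 - 1 / Real.log n) * n ≤ 2 * s ∧
    s * ((1.15 - 1 / Real.log n) * n) ≤ (1.15 - 1 / Real.log D) * (D : ℝ) := by
  set L := Real.log D with hL
  have hL41 : 41 ≤ L := by
    have := log_lower hD.le
    norm_num at this
    linarith
  have hD60 : (2 : ℝ) ^ 60 ≤ D := by exact_mod_cast hD.le
  have hD0 : (0 : ℝ) < D := lt_of_lt_of_le (by positivity) hD60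
  have hexpL : Real.exp L = D := Real.exp_log hD0
  set r := Real.exp (L / 2) with hr
  have hr0 : 0 < r := Real.exp_pos _
  have hr2 : r ^ 2 = D := by
    rw [← hexpL, hr, ← Real.exp_nat_mul]; congr 1; push_cast; ring
  have hr30 : (2 : ℝ) ^ 30 ≤ r := by
    apply le_of_sq_le_sq _ hr0.le
    rw [hr2, ← pow_mul]; exact hD60
  -- exp (L / 6) bound
  have he6 : 8.5 * L ≤ Real.exp (L / 6) := by
    have h1 : Real.exp (L / 6) = Real.exp 1 ^ 6 * Real.exp (L / 6 - 6) := by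
      rw [← Real.exp_nat_mul, ← Real.exp_add]; congr 1; push_cast; ring
    have h2 : (387 : ℝ) ≤ Real.exp 1 ^ 6 := by
      have := Real.exp_one_gt_d9
      calc (387 : ℝ) ≤ 2.7 ^ 6 := by norm_num
        _ ≤ _ := by gcongr; linarith
    have h3 : L / 6 - 6 + 1 ≤ Real.exp (L / 6 - 6) := Real.add_one_le_exp _
    rw [h1]
    have h4 : (387 : ℝ) * (L / 6 - 6 + 1) ≤ Real.exp 1 ^ 6 * Real.exp (L / 6 - 6) := by
      apply mul_le_mul h2 h3 (by linarith) (by positivity)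
    linarith
  have hr3 : r = Real.exp (L / 6) ^ 3 := by
    rw [hr, ← Real.exp_nat_mul]; congr 1; push_cast; ring
  have hrL : 600 * L ^ 3 ≤ r := by
    rw [hr3]
    have : (8.5 * L) ^ 3 ≤ Real.exp (L / 6) ^ 3 := by gcongr
    have hL3 : 0 ≤ L ^ 3 := by positivity
    rw [mul_pow] at this
    norm_num at this
    linarith
  have hL0 : 0 < L := by linarith
  have hrL1 : 600 * L ≤ r := by nlinarith [sq_nonneg L]
  -- s
  obtain ⟨s, hsp, hs1, hs2⟩ := Nat.exists_prime_lt_and_le_two_mul (Nat.sqrt D + 1) (by omega)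
  have hsr : r ≤ s := by
    have h1 : D < (Nat.sqrt D + 1) ^ 2 := by
      rw [pow_two]; exact Nat.lt_succ_sqrt D
    have h2 : (D : ℝ) ≤ (s : ℝ) ^ 2 := by
      exact_mod_cast h1.le.trans (Nat.pow_le_pow_left hs1.le 2)
    rw [← hr2] at h2
    exact le_of_sq_le_sq h2 (by positivity)
  have hsr2 : (s : ℝ) ≤ 2.04 * r := by
    have h1 : ((Nat.sqrt D : ℕ) : ℝ) ^ 2 ≤ r ^ 2 := by
      rw [hr2]; exact_mod_cast Nat.sqrt_le' D
    have h2 : ((Nat.sqrt D : ℕ) : ℝ) ≤ r := le_of_sq_le_sq h1 hr0.le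
    have h3 : (s : ℝ) ≤ 2 * ((Nat.sqrt D : ℕ) + 1) := by exact_mod_cast hs2
    linarith
  have hs0 : (0 : ℝ) < s := by linarith
  set δ := 0.2 / L with hδ
  have hδ0 : 0 < δ := by positivity
  have hδL : δ * L = 0.2 := by rw [hδ]; field_simp
  have hδ1 : δ ≤ 0.005 := by
    rw [hδ, div_le_iff₀ hL0]; linarith
  set μ := (D : ℝ) / s with hμ
  have hμ0 : 0 < μ := by positivity
  have hμs : μ * s = D := by rw [hμ]; field_simp
  have hμr : 0.49 * r ≤ μ := by
    rw [hμ, le_div_iff₀ hs0, ← hr2]; nlinarith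
  have hμr2 : μ ≤ r := by
    rw [hμ, div_le_iff₀ hs0, ← hr2]; nlinarith
  set n := ⌈(1 + δ) * μ⌉₊ with hn
  have hn1 : (1 + δ) * μ ≤ n := Nat.le_ceil _
  have hn2 : (n : ℝ) < (1 + δ) * μ + 1 := Nat.ceil_lt_add_one (by positivity)
  have hn28 : (2 : ℝ) ^ 28 ≤ n := by nlinarith
  have hnr : (n : ℝ) ≤ 1.01 * r := by nlinarith
  have hn0 : (0 : ℝ) < n := by linarith
  have hsn : (s : ℝ) * n ≤ (1 + 2 * δ) * D := by
    have h1 : (s : ℝ) * n ≤ s * ((1 + δ) * μ + 1) := by gcongr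
    have h2 : s * ((1 + δ) * μ + 1) = (1 + δ) * D + s := by rw [← hμs]; ring
    have h3 : (s : ℝ) ≤ δ * D := by
      rw [← hr2]
      have : 120 ≤ δ * r := by nlinarith
      nlinarith
    linarith
  have hlogn : Real.log n ≤ 2 / 3 * L := by
    rw [Real.log_le_iff_le_exp hn0]
    have h1 : Real.exp (2 / 3 * L) = Real.exp (L / 6) * r := by
      rw [hr, ← Real.exp_add]; congr 1; ring
    rw [h1]
    exact hnr.trans (mul_le_mul_of_nonneg_right (by linarith) hr0.le)
  have hlogn0 : 0 < Real.log n := Real.log_pos (by linarith)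
  have hinv : 1.5 / L ≤ 1 / Real.log n := by
    rw [div_le_div_iff₀ hL0 hlogn0]; linarith
  have hinv' : 1.5 / L = 7.5 * δ := by rw [hδ]; ring
  have hinvD : 1 / L = 5 * δ := by rw [hδ]; ring
  refine ⟨s, n, 1 + δ, hsp, by linarith, ?_, by exact_mod_cast hn28, ?_, ?_, ?_⟩
  · have h1 : (1 + (1 + δ - 1) / s) ^ D ≤ Real.exp (δ * μ) := by
      have : δ * μ = D * ((1 + δ - 1) / s) := by rw [hμ]; ring
      rw [this, Real.exp_nat_mul]
      have h0 : 0 ≤ (1 + δ - 1) / s := by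
        apply div_nonneg _ hs0.le; linarith
      gcongr
      rw [add_comm]
      exact Real.add_one_le_exp _
    have h2 : Real.exp (μ * (δ + δ ^ 2 / 3)) ≤ (1 + δ) ^ (n + 1) := by
      have e1 : 2 * δ / (δ + 2) ≤ Real.log (1 + δ) := Real.le_log_one_add_of_nonneg hδ0.le
      have e2 : δ + δ ^ 2 / 3 ≤ (1 + δ) * Real.log (1 + δ) := by
        have : δ + δ ^ 2 / 3 ≤ (1 + δ) * (2 * δ / (δ + 2)) := by
          rw [← mul_div_assoc, le_div_iff₀ (by positivity)]
          nlinarith [sq_nonneg δ]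
        refine this.trans ?_
        gcongr
      have e3 : (1 + δ) ^ (n + 1) = Real.exp ((n + 1 : ℕ) * Real.log (1 + δ)) := by
        rw [Real.exp_nat_mul, Real.exp_log (by positivity)]
      rw [e3]
      apply Real.exp_le_exp.mpr
      have e4 : 0 ≤ Real.log (1 + δ) := Real.log_nonneg (by linarith)
      calc μ * (δ + δ ^ 2 / 3) ≤ μ * ((1 + δ) * Real.log (1 + δ)) := by gcongr
        _ = ((1 + δ) * μ) * Real.log (1 + δ) := by ring
        _ ≤ _ := by
          gcongr
          push_cast
          linarith
    have h3 : (1 + (1 + δ - 1) / s) ^ D / (1 + δ) ^ (n + 1) ≤ Real.exp (-(3 * L)) := by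
      rw [div_le_iff₀ (by positivity)]
      refine h1.trans ?_
      refine le_trans ?_ (mul_le_mul_of_nonneg_left h2 (Real.exp_pos _).le)
      rw [← Real.exp_add]
      apply Real.exp_le_exp.mpr
      have : 9 * L ≤ μ * δ ^ 2 := by
        have a1 : 294 * L ^ 3 ≤ μ := by linarith
        calc 9 * L ≤ 294 * L * (δ * L) ^ 2 := by rw [hδL]; nlinarith
          _ = 294 * L ^ 3 * δ ^ 2 := by ring
          _ ≤ _ := by gcongr
      linarith
    have h4 : Real.exp (-(3 * L)) = 1 / (D : ℝ) ^ 3 := by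
      rw [Real.exp_neg, ← hexpL, ← Real.exp_nat_mul]; norm_num
    rw [h4] at h3
    refine (mul_le_mul_of_nonneg_left h3 hs0.le).trans ?_
    rw [mul_one_div, div_le_div_iff₀ (by positivity) (by positivity), one_mul]
    have h5 : (s : ℝ) * 8 ≤ D := by rw [← hr2]; nlinarith
    calc (s : ℝ) * (4 * D * (D + 1)) ≤ s * (4 * D * (2 * D)) := by gcongr; linarith
      _ = (s * 8) * (D * D) := by ring
      _ ≤ D * (D * D) := by gcongr
      _ = _ := by ring
  · have : (n : ℝ) < D := by rw [← hr2]; nlinarith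
    exact_mod_cast this
  · have : 0 < 1 / Real.log n := by positivity
    nlinarith
  · rw [hinvD]
    have h1 : 1.15 - 1 / Real.log n ≤ 1.15 - 7.5 * δ := by linarith
    calc (s : ℝ) * ((1.15 - 1 / Real.log n) * n) = (1.15 - 1 / Real.log n) * (s * n) := by ring
      _ ≤ (1.15 - 7.5 * δ) * (s * n) := by gcongr
      _ ≤ (1.15 - 7.5 * δ) * ((1 + 2 * δ) * D) := by
        gcongr; linarith
      _ = ((1.15 - 7.5 * δ) * (1 + 2 * δ)) * D := by ring
      _ ≤ _ := by gcongr; nlinarith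

open Classical in
lemma claim {V : Type*} [Fintype V] (D : ℕ) : 2 ^ 28 ≤ D → ∀ G : SimpleGraph V,
    (∀ v, G.degree v ≤ D) → ∃ ψ : Sym2 V → ℕ, ∃ k : ℕ, PC G ψ ∧
      (∀ a b, G.Adj a b → ψ s(a, b) < k) ∧ (k : ℝ) ≤ (1.15 - 1 / Real.log D) * D ∧ Cnt G ψ k := by
  induction D using Nat.strong_induction_on with
  | _ D ih =>
  intro hD G hdeg
  by_cases hbig : D ≤ 2 ^ 60
  · obtain ⟨ψ, h1, h2⟩ := vizing G D hdeg
    refine ⟨ψ, D + 1, h1, h2, ?_, Cnt.small (by omega)⟩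
    have hl := log_lower hD
    norm_num at hl
    have h3 : 1 / Real.log D ≤ 1 / 19 := by
      apply one_div_le_one_div_of_le (by norm_num); linarith
    have hD' : (2 : ℝ) ^ 28 ≤ D := by exact_mod_cast hD
    push_cast
    nlinarith
  · obtain ⟨s, n, x, hsp, hx, hnum, hn28, hnD, hk2, hkk⟩ := params D (by omega)
    have : Fact s.Prime := ⟨hsp⟩
    obtain ⟨f, hf⟩ := labels (Q := ZMod s) G D n (by omega) hdeg x hx (by rw [ZMod.card]; exact hnum)
    have hH : ∀ i : ZMod s, ∀ v, (Hs G f i).degree v ≤ n := by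
      intro i v
      refine le_trans ?_ (hf v (i - f v))
      rw [← SimpleGraph.card_neighborFinset_eq_degree]
      apply Finset.card_le_card
      intro u hu
      rw [SimpleGraph.mem_neighborFinset] at hu
      refine (@Finset.mem_filter _ _ (_) _ _).mpr ?_
      rw [SimpleGraph.mem_neighborFinset]
      exact ⟨hu.1, by rw [← hu.2]; ring⟩
    choose φ k h1 h2 h3 h4 using fun i => ih n hnD hn28 (Hs G f i) (hH i)
    have hk' : ∀ i, k i ≤ ⌊(1.15 - 1 / Real.log n) * n⌋₊ := fun i => Nat.le_floor (h3 i)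
    have hnn : 0 ≤ (1.15 - 1 / Real.log n) * n := le_trans (Nat.cast_nonneg _) (h3 0)
    have hfl := Nat.floor_le hnn
    obtain ⟨r1, r2, r3⟩ := combine G f ⌊(1.15 - 1 / Real.log n) * n⌋₊ φ h1
      (fun i a b hab => (h2 i a b hab).trans_le (hk' i)) (fun i => (h4 i).mono (h2 i))
      (by exact_mod_cast hfl.trans hk2)
    refine ⟨_, _, r1, r2, ?_, r3⟩
    push_cast
    refine le_trans ?_ hkk
    gcongr

open Finset

lemma Full.swap {V : Type*} {G : SimpleGraph V} {ψ : Sym2 V → ℕ} {c d : ℕ} {x : V}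
    (h : Full G ψ c d x) : Full G ψ d c x := by
  have hHH : HH G ψ d c = HH G ψ c d := by
    ext u v
    simp only [HH]
    tauto
  intro y hy
  rw [hHH] at hy
  exact (h y hy).symm

theorem acyclic_chromatic_index_bound_girth_219 {V : Type*} [Fintype V] [DecidableEq V]
    (G : SimpleGraph V) [DecidableRel G.Adj] (Δ : ℕ)
    (hdeg : ∀ v, G.degree v ≤ Δ)
    (hgirth : ∀ (v : V) (w : G.Walk v v), w.IsCycle → 219 ≤ w.length) :
    ∃ col : Sym2 V → ℕ,
      (∀ e ∈ G.edgeSet, col e < ⌈(2.323 : ℝ) * ((Δ : ℝ) - 1)⌉₊ + 1) ∧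
      IsProperEdgeColoring G col ∧
      ∀ (v : V) (w : G.Walk v v), w.IsCycle →
        3 ≤ (w.edges.map col).toFinset.card := by
  have hdeg' : ∀ v, @SimpleGraph.degree V G v
      (@SimpleGraph.neighborSetFintype V G _ (Classical.decRel _) v) ≤ Δ := by
    intro v
    convert hdeg v
  -- it suffices to bound the number of colors
  have fin : ∀ m : ℕ, (m : ℝ) < (2.323 : ℝ) * ((Δ : ℝ) - 1) + 2 →
      (∃ col : Sym2 V → ℕ, (∀ e ∈ G.edgeSet, col e < m) ∧
      IsProperEdgeColoring G col ∧
      ∀ (v : V) (w : G.Walk v v), w.IsCycle →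
        3 ≤ (w.edges.map col).toFinset.card) → ∃ col : Sym2 V → ℕ,
      (∀ e ∈ G.edgeSet, col e < ⌈(2.323 : ℝ) * ((Δ : ℝ) - 1)⌉₊ + 1) ∧
      IsProperEdgeColoring G col ∧
      ∀ (v : V) (w : G.Walk v v), w.IsCycle →
        3 ≤ (w.edges.map col).toFinset.card := by
    rintro m hm ⟨col, h1, h2⟩
    refine ⟨col, fun e he => (h1 e he).trans_le ?_, h2⟩
    have := Nat.le_ceil ((2.323 : ℝ) * ((Δ : ℝ) - 1))
    have h3 : (m : ℝ) < ((⌈(2.323 : ℝ) * ((Δ : ℝ) - 1)⌉₊ + 2 : ℕ) : ℝ) := by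
      push_cast; linarith
    have h4 : m < ⌈(2.323 : ℝ) * ((Δ : ℝ) - 1)⌉₊ + 2 := by exact_mod_cast h3
    omega
  rcases Nat.lt_or_ge Δ 2 with h1 | h1
  · -- at most one edge at each vertex
    have huniq : ∀ v u w, G.Adj v u → G.Adj v w → u = w := by
      intro v u w hu hw
      have hc : #(G.neighborFinset v) ≤ 1 := by
        rw [SimpleGraph.card_neighborFinset_eq_degree]
        exact (hdeg v).trans (by omega)
      exact Finset.card_le_one.mp hc u (by simpa using hu) w (by simpa using hw)
    refine ⟨fun _ => 0, fun e _ => by simp, ?_, ?_⟩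
    · rintro e₁ he₁ e₂ he₂ hne ⟨v, ⟨u, rfl⟩, ⟨w, rfl⟩⟩
      exact absurd (by rw [huniq v u w he₁ he₂]) hne
    · intro v w hw
      exfalso
      cases w with
      | nil => exact hw.ne_nil rfl
      | cons h p =>
        cases p with
        | nil => exact h.ne rfl
        | cons h' q =>
          have e := huniq _ _ _ h.symm h'
          subst e
          have := hw.edges_nodup
          simp [Sym2.eq_swap] at this
  rcases Nat.lt_or_ge Δ 5 with h2 | h2
  · obtain ⟨ψ, p1, p2, p3⟩ := small_coloring G Δ (by omega) hdeg'
    have h1' : (2 : ℝ) ≤ Δ := by exact_mod_cast h1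
    refine fin (2 * (Δ + 1) - 2) ?_ (assemble (z := 2) p1 p2 (Cnt.small (by omega)) (by omega)
      ?_ hgirth)
    · have : 2 * (Δ + 1) - 2 = 2 * Δ := by omega
      rw [this]
      push_cast
      linarith
    · intro c d x hc hd hcd hF
      have : (c = 0 ∧ d = 1) ∨ (c = 1 ∧ d = 0) := by omega
      rcases this with ⟨rfl, rfl⟩ | ⟨rfl, rfl⟩
      · exact p3 x hF
      · exact p3 x hF.swap
  have h2' : (5 : ℝ) ≤ Δ := by exact_mod_cast h2
  rcases Nat.lt_or_ge (2 ^ 60) Δ with h3 | h3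
  · obtain ⟨ψ, k, p1, p2, p3, p4⟩ := claim Δ (by omega) G hdeg'
    have h3' : (2 : ℝ) ^ 60 ≤ Δ := by exact_mod_cast h3.le
    refine fin (2 * k - 0) ?_ (assemble (z := 0) p1 p2 p4 (by omega)
      (fun c d x hc => absurd hc (by omega)) hgirth)
    have hl : 0 < 1 / Real.log Δ := by
      have : 0 < Real.log Δ := Real.log_pos (by linarith)
      positivity
    rw [Nat.sub_zero]
    push_cast
    nlinarith
  · obtain ⟨ψ, p1, p2⟩ := vizing G Δ hdeg'
    refine fin (2 * (Δ + 1) - 1) ?_ (assemble (z := 1) p1 p2 (Cnt.small (by omega)) (by omega)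
      (fun c d x hc hd hcd => absurd hcd (by omega)) hgirth)
    have : 2 * (Δ + 1) - 1 = 2 * Δ + 1 := by omega
    rw [this]
    push_cast
    linarith
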